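/- arXiv:1810.08128 — 3 statements merged into one kernel-verified Lean document; each statement's English description precedes it below -/
import Mathlib

section
/- In the closed-loop least-squares setup, suppose: |f(x)| ≤ k₁·e^{k₂|x|} for all x ∈ ℝ and some k₁, k₂ > 0; the set {x ∈ ℝ : |f(x)| > 0} has positive Lebesgue measure; and for some b < 4 and L > 0, the set S_b^L contains a nonempty open interval and liminf_{l→+∞} ℓ(S_b^L ∩ [−l, l])/l > 0. Then sup_t σ_t < +∞ almost surely. -/
open MeasureTheory ProbabilityTheory Filter

noncomputable def gk (v : ℝ) (A : Set ℝ) : ℝ :=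
  (2 * Real.pi * v) ^ (-(1 : ℝ) / 2) * ∫ x in A, Real.exp (-x ^ 2 / (2 * v))

lemma lem_cond {Ω : Type*} {m mΩ : MeasurableSpace Ω} (hm : m ≤ mΩ) (P : Measure Ω)
    [IsProbabilityMeasure P] (Y : Ω → ℝ) (hY : Measurable Y) (A : Set ℝ) (hA : MeasurableSet A)
    (F : Ω → ℝ) (hF0 : ∀ ω, 0 ≤ F ω)
    (h : (P[Set.indicator {ω | Y ω ∈ A} (fun _ => (1 : ℝ))|m]) =ᵐ[P] F)
    (g : Ω → ENNReal) (hg : Measurable[m] g) :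
    ∫⁻ ω, g ω * Set.indicator {ω | Y ω ∈ A} (fun _ => (1 : ENNReal)) ω ∂P
      = ∫⁻ ω, g ω * ENNReal.ofReal (F ω) ∂P := by
  have hYA : MeasurableSet {ω | Y ω ∈ A} := hY hA
  have hFint : Integrable F P := integrable_condExp.congr h
  have hμ : (P.restrict {ω | Y ω ∈ A}).trim hm
      = (P.withDensity (fun ω => ENNReal.ofReal (F ω))).trim hm := by
    refine @Measure.ext _ m _ _ fun s hs => ?_
    rw [trim_measurableSet_eq hm hs, trim_measurableSet_eq hm hs,
      Measure.restrict_apply (hm s hs), withDensity_apply _ (hm s hs),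
      ← ofReal_integral_eq_lintegral_ofReal hFint.integrableOn (ae_of_all _ hF0),
      ← setIntegral_congr_ae (hm s hs) (h.mono fun ω hω _ => hω),
      setIntegral_condExp hm ((integrable_const 1).indicator hYA) hs,
      setIntegral_indicator hYA]
    simp
  have h1 := lintegral_trim (μ := P.restrict {ω | Y ω ∈ A}) hm hg
  have h2 := lintegral_trim (μ := P.withDensity (fun ω => ENNReal.ofReal (F ω))) hm hg
  rw [hμ, h2, lintegral_withDensity_eq_lintegral_mul₀ hFint.aemeasurable.ennreal_ofReal
    (hg.mono hm le_rfl).aemeasurable] at h1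
  rw [← lintegral_indicator hYA] at h1
  convert h1.symm using 1
  · refine lintegral_congr fun ω => ?_
    by_cases hω : Y ω ∈ A <;> simp [Set.indicator, hω]
  · refine lintegral_congr fun ω => ?_
    simp [mul_comm]

lemma lem_kappa {Ω : Type*} {m mΩ : MeasurableSpace Ω} (hm : m ≤ mΩ) (P : Measure Ω)
    [IsProbabilityMeasure P] (Y : Ω → ℝ) (hY : Measurable Y) (A : ℕ → Set ℝ)
    (hA : ∀ k, MeasurableSet (A k))
    (F : ℕ → Ω → ℝ) (hF0 : ∀ k ω, 0 ≤ F k ω)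
    (h : ∀ k, (P[Set.indicator {ω | Y ω ∈ A k} (fun _ => (1 : ℝ))|m]) =ᵐ[P] F k)
    (κ : Ω → ℕ) (hκ : Measurable[m] κ)
    (g : Ω → ENNReal) (hg : Measurable[m] g) :
    ∫⁻ ω, g ω * Set.indicator {ω | Y ω ∈ A (κ ω)} (fun _ => (1 : ENNReal)) ω ∂P
      = ∫⁻ ω, g ω * ENNReal.ofReal (F (κ ω) ω) ∂P := by
  have hs : ∀ k, MeasurableSet[m] {ω | κ ω = k} := fun k => hκ (measurableSet_singleton k)
  have hgk : ∀ k, Measurable[m] ({ω | κ ω = k}.indicator g) := fun k => hg.indicator (hs k)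
  have hFint : ∀ k, Integrable (F k) P := fun k => integrable_condExp.congr (h k)
  have key := fun k => lem_cond hm P Y hY (A k) (hA k) (F k) (hF0 k) (h k) _ (hgk k)
  have e : ∀ X : ℕ → Ω → ENNReal, ∀ ω, g ω * X (κ ω) ω
      = ∑' k, {ω | κ ω = k}.indicator g ω * X k ω := by
    intro X ω
    rw [tsum_eq_single (κ ω)]
    · simp
    · intro k hk
      simp [Set.indicator, hk.symm]
  have e1 : ∀ ω, g ω * Set.indicator {ω | Y ω ∈ A (κ ω)} (fun _ => (1 : ENNReal)) ω
      = ∑' k, {ω | κ ω = k}.indicator g ω *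
        Set.indicator {ω | Y ω ∈ A k} (fun _ => (1 : ENNReal)) ω := fun ω =>
    e (fun k => Set.indicator {ω | Y ω ∈ A k} (fun _ => (1 : ENNReal))) ω
  rw [lintegral_congr e1,
    lintegral_congr (e (fun k ω => ENNReal.ofReal (F k ω))),
    lintegral_tsum, lintegral_tsum]
  · exact tsum_congr key
  · intro k
    exact ((hgk k).mono hm le_rfl).aemeasurable.mul (hFint k).aemeasurable.ennreal_ofReal
  · intro k
    exact (((hgk k).mono hm le_rfl).mul (measurable_const.indicator (hY (hA k)))).aemeasurable

lemma lem_det (b : ℝ) (hb0 : 0 < b) (hb : b < 4) :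
    ∃ N : ℕ, ∀ A d : ℕ → ℝ, (∀ i ≤ N, 0 < d i) → 0 ≤ A 0 →
      (∀ i < N, A (i + 1) = A i + d (i + 1)) → (∀ i < N, d (i + 1) ≤ b * d i - A i) → False := by
  obtain ⟨n, hn⟩ := exists_nat_gt (b / ((4 - b) / 4))
  have he : 0 < (4 - b) / 4 := by linarith
  rw [div_lt_iff₀ he] at hn
  refine ⟨n + 1, fun A d hd hA0 hA hdd => ?_⟩
  have hlt : ∀ i < n + 1, A i < b * d i := fun i hi => by
    have := hdd i hi
    have := hd (i + 1) (by omega)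
    linarith
  have hρ : ∀ i, i ≤ n → (i : ℝ) * ((4 - b) / 4) * d i ≤ A i := by
    intro i
    induction i with
    | zero => intro _; simpa using hA0
    | succ i ih =>
      intro hi
      have h1 := ih (by omega)
      have hdi := hd i (by omega)
      have hdi' := hd (i + 1) (by omega)
      have h2 := hdd i (by omega)
      rw [hA i (by omega)]
      push_cast
      set x : ℝ := (i : ℝ) * ((4 - b) / 4) with hx
      have hx0 : 0 ≤ x := by positivity
      obtain ⟨ρ, hρ⟩ : ∃ ρ, A i = ρ * d i := ⟨A i / d i, by field_simp⟩
      rw [hρ] at h1 h2 ⊢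
      have hxρ : x ≤ ρ := le_of_mul_le_mul_right h1 hdi
      have h3 : ((i : ℝ) + 1) * ((4 - b) / 4) = x + (4 - b) / 4 := by rw [hx]; ring
      rw [h3]
      have h4 : (x + (4 - b) / 4) * d (i + 1) ≤ (ρ + (4 - b) / 4) * d (i + 1) := by gcongr
      suffices (ρ + (4 - b) / 4 - 1) * d (i + 1) ≤ ρ * d i by linarith
      by_cases hs : ρ + (4 - b) / 4 - 1 ≤ 0
      · have : 0 ≤ ρ * d i := mul_nonneg (hx0.trans hxρ) hdi.le
        nlinarith
      · push Not at hs
        have h5 : (ρ + (4 - b) / 4 - 1) * d (i + 1) ≤ (ρ + (4 - b) / 4 - 1) * (b * d i - ρ * d i) :=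
          mul_le_mul_of_nonneg_left h2 hs.le
        have h6 : 0 ≤ ρ - (ρ + (4 - b) / 4 - 1) * (b - ρ) := by
          nlinarith [sq_nonneg (ρ - b / 2), mul_nonneg he.le (hx0.trans hxρ)]
        nlinarith [mul_nonneg h6 hdi.le]
  have h1 := hρ n le_rfl
  have h2 := hlt n (by omega)
  have h3 := hd n (by omega)
  nlinarith

/-- Uniform lower bound on a fixed set. -/
lemma lem_lower (f : ℝ → ℝ) (hf : Measurable f) (hpos : 0 < volume {x : ℝ | 0 < |f x|}) :
    ∃ δ : ℝ, 0 < δ ∧ ∀ M : ℝ, 1 ≤ M → ∃ q : ℝ, 0 < q ∧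
      ∀ v, 1 ≤ v → v ≤ M → q ≤ gk v {x | δ < |f x|} := by
  have hun : {x : ℝ | 0 < |f x|} = ⋃ n : ℕ, {x | 1 / ((n : ℝ) + 1) < |f x|} := by
    ext x
    simp only [Set.mem_ofPred_eq, Set.mem_iUnion]
    exact ⟨fun h => exists_nat_one_div_lt h, fun ⟨n, hn⟩ => lt_trans (by positivity) hn⟩
  rw [hun] at hpos
  obtain ⟨n, hn⟩ := exists_measure_pos_of_not_measure_iUnion_null hpos.ne'
  refine ⟨1 / ((n : ℝ) + 1), by positivity, fun M hM => ?_⟩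
  set A := {x | 1 / ((n : ℝ) + 1) < |f x|} with hA
  have hAm : MeasurableSet A := measurableSet_lt measurable_const hf.abs
  have hint : ∀ v : ℝ, 1 ≤ v → Integrable (fun x : ℝ => Real.exp (-x ^ 2 / (2 * v))) := by
    intro v hv
    have := integrable_exp_neg_mul_sq (b := 1 / (2 * v)) (by positivity)
    refine this.congr (ae_of_all _ fun x => ?_)
    simp only; congr 1; ring
  refine ⟨(2 * Real.pi * M) ^ (-(1 : ℝ) / 2) * ∫ x in A, Real.exp (-x ^ 2 / (2 * 1)), ?_, ?_⟩
  · refine mul_pos (by positivity) ?_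
    rw [setIntegral_pos_iff_support_of_nonneg_ae (ae_of_all _ fun x => (Real.exp_pos _).le)
      (hint 1 le_rfl).integrableOn]
    have : Function.support (fun x : ℝ => Real.exp (-x ^ 2 / (2 * 1))) = Set.univ := by
      ext x; simp [Real.exp_ne_zero]
    rw [this, Set.univ_inter]; exact hn
  · intro v hv hvM
    unfold gk
    have hv0 : 0 < v := by linarith
    refine mul_le_mul ?_ ?_ (integral_nonneg fun x => (Real.exp_pos _).le) (by positivity)
    · exact Real.rpow_le_rpow_of_nonpos (by positivity) (by gcongr) (by norm_num)
    · refine setIntegral_mono (hint 1 le_rfl).integrableOn (hint v hv).integrableOn fun x => ?_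
      apply Real.exp_le_exp.2
      rw [neg_div, neg_div]
      apply neg_le_neg
      gcongr

/-- Markov type tail bound. -/
lemma lem_upper (f : ℝ → ℝ) (hf : Measurable f) (k₁ k₂ : ℝ) (hk₁ : 0 < k₁) (hk₂ : 0 < k₂)
    (hfgrow : ∀ x : ℝ, |f x| ≤ k₁ * Real.exp (k₂ * |x|)) (M c : ℝ) (hM : 1 ≤ M) (hc : 0 < c) :
    ∃ K : ℝ, 0 < K ∧ ∀ v, 1 ≤ v → v ≤ M → ∀ k : ℕ,
      gk v {x | c * (k + 1) ≤ f x ^ 2 + c} ≤ K / ((k : ℝ) + 1) ^ 2 := by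
  set h : ℝ → ℝ := fun x => (f x ^ 2 + c) ^ 2 * Real.exp (-x ^ 2 / (2 * M)) with hh
  have hM0 : 0 < M := by linarith
  have hint : Integrable h := by
    have i1 := integrable_exp_neg_mul_sq (b := 1 / (4 * M)) (by positivity)
    have i2 := i1.const_mul ((k₁ ^ 2 + c) ^ 2 * Real.exp (16 * M * k₂ ^ 2))
    refine i2.mono' (by fun_prop) (ae_of_all _ fun x => ?_)
    rw [Real.norm_of_nonneg (by positivity)]
    have e1 : f x ^ 2 + c ≤ (k₁ ^ 2 + c) * Real.exp (2 * (k₂ * |x|)) := by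
      have : f x ^ 2 ≤ (k₁ * Real.exp (k₂ * |x|)) ^ 2 := by
        rw [← sq_abs]; exact pow_le_pow_left₀ (abs_nonneg _) (hfgrow x) 2
      have e2 : Real.exp (k₂ * |x|) ^ 2 = Real.exp (2 * (k₂ * |x|)) := by
        rw [← Real.exp_nat_mul]; norm_num
      rw [mul_pow, e2] at this
      have : 1 ≤ Real.exp (2 * (k₂ * |x|)) := Real.one_le_exp (by positivity)
      nlinarith
    have e3 : (f x ^ 2 + c) ^ 2 ≤ (k₁ ^ 2 + c) ^ 2 * Real.exp (4 * (k₂ * |x|)) := by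
      have := pow_le_pow_left₀ (by positivity) e1 2
      have e2 : Real.exp (2 * (k₂ * |x|)) ^ 2 = Real.exp (4 * (k₂ * |x|)) := by
        rw [← Real.exp_nat_mul]; congr 1; push_cast; ring
      rwa [mul_pow, e2] at this
    calc h x ≤ (k₁ ^ 2 + c) ^ 2 * Real.exp (4 * (k₂ * |x|)) * Real.exp (-x ^ 2 / (2 * M)) := by
          simp only [hh]; gcongr
      _ = (k₁ ^ 2 + c) ^ 2 * Real.exp (4 * (k₂ * |x|) + -x ^ 2 / (2 * M)) := by
          rw [Real.exp_add]; ring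
      _ ≤ (k₁ ^ 2 + c) ^ 2 * Real.exp (16 * M * k₂ ^ 2 + -(1 / (4 * M)) * x ^ 2) := by
          refine mul_le_mul_of_nonneg_left (Real.exp_le_exp.2 ?_) (by positivity)
          have : 0 ≤ (|x| - 8 * M * k₂) ^ 2 / (4 * M) := by positivity
          have e : (|x| - 8 * M * k₂) ^ 2 / (4 * M)
            = 16 * M * k₂ ^ 2 + -(1 / (4 * M)) * x ^ 2 - (4 * (k₂ * |x|) + -x ^ 2 / (2 * M)) := by
            rw [← sq_abs x]; field_simp; ring
          linarith
      _ = _ := by rw [Real.exp_add]; ring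
  have hI : 0 ≤ ∫ x, h x := integral_nonneg fun x => by simp only [hh]; positivity
  refine ⟨((∫ x, h x) + 1) / c ^ 2, by positivity, fun v hv hvM k => ?_⟩
  have hv0 : 0 < v := by linarith
  set A := {x | c * ((k : ℝ) + 1) ≤ f x ^ 2 + c} with hA
  have hAm : MeasurableSet A := measurableSet_le measurable_const (by fun_prop)
  have h1 : (2 * Real.pi * v) ^ (-(1 : ℝ) / 2) ≤ 1 := by
    apply Real.rpow_le_one_of_one_le_of_nonpos _ (by norm_num)
    nlinarith [Real.pi_gt_three]
  have h2 : ∫ x in A, Real.exp (-x ^ 2 / (2 * v)) ≤ ∫ x in A, h x / (c * ((k : ℝ) + 1)) ^ 2 := by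
    have hg : Integrable (fun x : ℝ => Real.exp (-x ^ 2 / (2 * v))) := by
      have := integrable_exp_neg_mul_sq (b := 1 / (2 * v)) (by positivity)
      refine this.congr (ae_of_all _ fun x => ?_)
      simp only; congr 1; ring
    refine setIntegral_mono_on hg.integrableOn (hint.div_const _).integrableOn hAm fun x hx => ?_
    rw [le_div_iff₀ (by positivity), mul_comm]
    simp only [hh]
    have hx' : c * ((k : ℝ) + 1) ≤ f x ^ 2 + c := hx
    refine mul_le_mul (pow_le_pow_left₀ (by positivity) hx' 2) (Real.exp_le_exp.2 ?_)
      (Real.exp_pos _).le (by positivity)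
    rw [neg_div, neg_div]
    apply neg_le_neg
    gcongr
  have h3 : ∫ x in A, h x / (c * ((k : ℝ) + 1)) ^ 2 ≤ ∫ x, h x / (c * ((k : ℝ) + 1)) ^ 2 :=
    setIntegral_le_integral (hint.div_const _) (ae_of_all _ fun x => by
      simp only [hh]; positivity)
  have h4 : ∫ x, h x / (c * ((k : ℝ) + 1)) ^ 2 = (∫ x, h x) / (c * ((k : ℝ) + 1)) ^ 2 :=
    integral_div _ _
  rw [h4] at h3
  calc gk v A ≤ 1 * ((∫ x, h x) / (c * ((k : ℝ) + 1)) ^ 2) := by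
        unfold gk
        exact mul_le_mul h1 (h2.trans h3) (integral_nonneg fun x => (Real.exp_pos _).le) (by norm_num)
    _ ≤ ((∫ x, h x) + 1) / (c * ((k : ℝ) + 1)) ^ 2 := by
        rw [one_mul]; gcongr; linarith
    _ = _ := by rw [mul_pow, div_div]

lemma lem_dens (S : Set ℝ) (hS : MeasurableSet S)
    (hliminf : 0 < Filter.liminf (fun l : ℝ =>
      (volume (S ∩ Set.Icc (-l) l)).toReal / l) Filter.atTop) :
    ∃ M₀ p : ℝ, 1 ≤ M₀ ∧ 0 < p ∧ p ≤ 1 ∧ ∀ v, M₀ < v →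
      p ≤ gk v (S ∩ {x | 1 ≤ |x| ∧ |x| ≤ (⌊Real.sqrt v⌋₊ : ℝ)}) := by
  have hbdd : IsBoundedUnder (· ≥ ·) atTop
      (fun l : ℝ => (volume (S ∩ Set.Icc (-l) l)).toReal / l) :=
    isBoundedUnder_of_eventually_ge (a := 0)
      ((eventually_gt_atTop 0).mono fun l hl => by positivity)
  obtain ⟨c, hc0, hc⟩ := exists_between hliminf
  obtain ⟨l₀, hl₀⟩ := eventually_atTop.1 (eventually_lt_of_lt_liminf hc hbdd)
  set C := max l₀ (max (4 / c) 1) with hC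
  have hC1 : 1 ≤ C := (le_max_right _ _).trans (le_max_right _ _)
  have hC2 : 4 / c ≤ C := (le_max_left _ _).trans (le_max_right _ _)
  have hC3 : l₀ ≤ C := le_max_left _ _
  set p := (2 * Real.pi) ^ (-(1 : ℝ) / 2) * Real.exp (-1 / 2) * (c / 4) with hp
  have hp0 : 0 < p := by positivity
  refine ⟨(C + 1) ^ 2, min p 1, by nlinarith, lt_min hp0 one_pos, min_le_right _ _,
    fun v hv => (min_le_left _ _).trans ?_⟩
  have hv0 : 0 < v := lt_of_le_of_lt (by positivity) hv
  have hsv : C + 1 < Real.sqrt v := Real.lt_sqrt_of_sq_lt hv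
  set k : ℕ := ⌊Real.sqrt v⌋₊ with hk
  have hk1 : (k : ℝ) ≤ Real.sqrt v := Nat.floor_le (Real.sqrt_nonneg _)
  have hk2 : Real.sqrt v < k + 1 := Nat.lt_floor_add_one _
  have hkC : C ≤ k := by linarith
  have hk0 : (0 : ℝ) < k := by linarith
  set A := S ∩ {x | 1 ≤ |x| ∧ |x| ≤ (k : ℝ)} with hA
  have hAm : MeasurableSet A := by
    refine hS.inter ?_
    exact (measurableSet_le measurable_const measurable_id.abs).inter
      (measurableSet_le measurable_id.abs measurable_const)
  have hAsub : A ⊆ Set.Icc (-(k : ℝ)) k := fun x hx => abs_le.1 hx.2.2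
  have hAfin : volume A ≠ ⊤ := ((measure_mono hAsub).trans_lt (by simp)).ne
  have hvolA : c / 2 * k ≤ (volume A).toReal := by
    have h1 := hl₀ k (hC3.trans hkC)
    rw [lt_div_iff₀ hk0] at h1
    have h2 : S ∩ Set.Icc (-(k : ℝ)) k ⊆ A ∪ Set.Icc (-1) 1 := by
      intro x hx
      by_cases h : 1 ≤ |x|
      · left; exact ⟨hx.1, h, abs_le.2 hx.2⟩
      · right; exact abs_le.1 (not_le.1 h).le
    have h3 : (volume (S ∩ Set.Icc (-(k : ℝ)) k)).toReal ≤ (volume A).toReal + 2 := by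
      have h4 : volume (S ∩ Set.Icc (-(k : ℝ)) k) ≤ volume A + ENNReal.ofReal 2 := by
        refine (measure_mono h2).trans ((measure_union_le _ _).trans ?_)
        rw [Real.volume_Icc]; norm_num
      have := ENNReal.toReal_mono (by simp [hAfin]) h4
      rwa [ENNReal.toReal_add hAfin (by simp), ENNReal.toReal_ofReal (by norm_num)] at this
    have h5 : 4 ≤ c * k := by
      have := hC2.trans hkC
      rw [div_le_iff₀ hc0] at this; linarith
    linarith
  have hint : ∫ x in A, Real.exp (-1 / 2) ≤ ∫ x in A, Real.exp (-x ^ 2 / (2 * v)) := by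
    have hg : Integrable (fun x : ℝ => Real.exp (-x ^ 2 / (2 * v))) := by
      have := integrable_exp_neg_mul_sq (b := 1 / (2 * v)) (by positivity)
      refine this.congr (ae_of_all _ fun x => ?_)
      simp only; congr 1; ring
    refine setIntegral_mono_on (integrableOn_const hAfin) hg.integrableOn hAm fun x hx => ?_
    apply Real.exp_le_exp.2
    have : x ^ 2 ≤ v := by
      rw [← sq_abs, ← Real.sq_sqrt hv0.le]
      exact pow_le_pow_left₀ (abs_nonneg _) (hx.2.2.trans hk1) 2
    rw [neg_div, neg_div]
    apply neg_le_neg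
    rw [div_le_div_iff₀ (by positivity) (by norm_num)]
    linarith
  rw [setIntegral_const, smul_eq_mul] at hint
  have hr : (2 * Real.pi * v) ^ (-(1 : ℝ) / 2)
      = (2 * Real.pi) ^ (-(1 : ℝ) / 2) * (Real.sqrt v)⁻¹ := by
    rw [Real.mul_rpow (by positivity) hv0.le, Real.sqrt_eq_rpow, ← Real.rpow_neg hv0.le]
    norm_num
  unfold gk
  have hsv0 : 0 < Real.sqrt v := by linarith
  have hkey : c / 4 ≤ (Real.sqrt v)⁻¹ * (volume A).toReal := by
    rw [inv_mul_eq_div, le_div_iff₀ hsv0]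
    nlinarith
  calc p ≤ (2 * Real.pi) ^ (-(1 : ℝ) / 2) * Real.exp (-1 / 2) *
        ((Real.sqrt v)⁻¹ * (volume A).toReal) := by rw [hp]; gcongr
    _ = (2 * Real.pi * v) ^ (-(1 : ℝ) / 2) * ((volume A).toReal * Real.exp (-1 / 2)) := by
        rw [hr]; ring
    _ ≤ _ := by gcongr; exact hint

lemma lem_rec {Ω : Type*} [mΩ : MeasurableSpace Ω] (P : Measure Ω) [IsProbabilityMeasure P]
    (𝔉 : ℕ → MeasurableSpace Ω) (hm : ∀ t, 𝔉 t ≤ mΩ) (hmono : Monotone 𝔉)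
    (B H : ℕ → Set Ω) (hB : ∀ t, MeasurableSet[𝔉 t] (B t))
    (hH : ∀ t, MeasurableSet[𝔉 (t + 1)] (H t)) (p : ℝ) (hp : 0 < p) (hp1 : p ≤ 1)
    (hstep : ∀ t D, MeasurableSet[𝔉 t] D → D ⊆ B t → p * P.real D ≤ P.real (D ∩ H t))
    (N : ℕ) (hdet : ∀ n ω, (∀ i ≤ N, ω ∈ B (n + i)) → (∀ i < N, ω ∈ H (n + i)) → False) :
    ∀ᵐ ω ∂P, ∃ᶠ t in atTop, ω ∉ B t := by
  suffices h : ∀ T, P (⋂ n, {ω | ∀ i ≤ n, ω ∈ B (T + i)}) = 0 by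
    have h' : ∀ T, ∀ᵐ ω ∂P, ω ∉ ⋂ n, {ω | ∀ i ≤ n, ω ∈ B (T + i)} := fun T =>
      measure_eq_zero_iff_ae_notMem.1 (h T)
    filter_upwards [ae_all_iff.2 h'] with ω hω
    rw [frequently_atTop]
    intro T
    by_contra hcon
    push Not at hcon
    apply hω T
    rw [Set.mem_iInter]
    intro n i _
    exact hcon (T + i) (by omega)
  intro T
  set E : ℕ → Set Ω := fun n => {ω | ∀ i ≤ n, ω ∈ B (T + i)} with hE
  have hEF : ∀ n, MeasurableSet[𝔉 (T + n)] (E n) := by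
    intro n
    have : E n = ⋂ i, ⋂ (_ : i ≤ n), B (T + i) := by ext ω; simp [hE]
    rw [this]
    exact MeasurableSet.iInter fun i => MeasurableSet.iInter fun hi =>
      hmono (by omega : T + i ≤ T + n) _ (hB (T + i))
  have hEm : ∀ n, MeasurableSet (E n) := fun n => hm _ _ (hEF n)
  have hEanti : Antitone E := fun a c hac ω hω i hi => hω i (hi.trans hac)
  set e := P.real (⋂ n, E n) with he
  have hEe : ∀ n, e ≤ P.real (E n) := fun n => measureReal_mono (Set.iInter_subset _ n)
  have htend : Tendsto (fun n => P.real (E n)) atTop (nhds e) := by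
    have := tendsto_measure_iInter_atTop (μ := P) (fun n => (hEm n).nullMeasurableSet) hEanti
      ⟨0, measure_ne_top _ _⟩
    exact (ENNReal.tendsto_toReal (measure_ne_top _ _)).comp this
  set K : ℕ → ℕ → Set Ω := fun n j => E (n + j) ∩ {ω | ∀ i < j, ω ∈ H (T + n + i)} with hK
  have hKF : ∀ n j, MeasurableSet[𝔉 (T + n + j)] (K n j) := by
    intro n j
    have h2 : {ω | ∀ i < j, ω ∈ H (T + n + i)} = ⋂ i, ⋂ (_ : i < j), H (T + n + i) := by
      ext ω; simp
    refine MeasurableSet.inter ?_ ?_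
    · have := hEF (n + j)
      rwa [← add_assoc] at this
    · rw [h2]
      exact MeasurableSet.iInter fun i => MeasurableSet.iInter fun hi =>
        hmono (by omega : T + n + i + 1 ≤ T + n + j) _ (hH (T + n + i))
  have hclaim : ∀ n j, p ^ j * e - (P.real (E n) - P.real (E (n + j))) ≤ P.real (K n j) := by
    intro n j
    induction j with
    | zero =>
      have : K n 0 = E n := by ext ω; simp [hK]
      rw [this]; simpa using hEe n
    | succ j ih =>
      have hsub : K n j ⊆ B (T + n + j) := fun ω hω => by
        have := hω.1 (n + j) le_rfl
        rwa [← add_assoc] at this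
      have h1 := hstep _ _ (hKF n j) hsub
      have h2 : K n j ∩ H (T + n + j) ⊆ K n (j + 1) ∪ (E (n + j) \ E (n + j + 1)) := by
        intro ω hω
        by_cases hω' : ω ∈ E (n + j + 1)
        · left
          refine ⟨hω', fun i hi => ?_⟩
          rcases Nat.lt_succ_iff_lt_or_eq.1 hi with h | h
          · exact hω.1.2 i h
          · rw [h]; exact hω.2
        · right; exact ⟨hω.1.1, hω'⟩
      have h3 : P.real (K n j ∩ H (T + n + j))
          ≤ P.real (K n (j + 1)) + (P.real (E (n + j)) - P.real (E (n + j + 1))) := by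
        refine (measureReal_mono h2).trans ((measureReal_union_le _ _).trans ?_)
        rw [measureReal_sdiff (hEanti (by omega)) (hEm _)]
      have h4 : P.real (E (n + j)) ≤ P.real (E n) := measureReal_mono (hEanti (by omega))
      have h5 : p * (p ^ j * e - (P.real (E n) - P.real (E (n + j)))) ≤ p * P.real (K n j) :=
        mul_le_mul_of_nonneg_left ih hp.le
      have h6 : p * (P.real (E n) - P.real (E (n + j))) ≤ P.real (E n) - P.real (E (n + j)) :=
        mul_le_of_le_one_left (by linarith) hp1
      rw [pow_succ]
      rw [← add_assoc]
      nlinarith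
  have hKN : ∀ n, K n N = ∅ := by
    intro n
    ext ω
    simp only [Set.mem_empty_iff_false, iff_false]
    intro hω
    refine hdet (T + n) ω (fun i hi => ?_) hω.2
    have := hω.1 (n + i) (by omega)
    rwa [← add_assoc] at this
  have hle : ∀ n, p ^ N * e ≤ P.real (E n) - P.real (E (n + N)) := by
    intro n
    have := hclaim n N
    rw [hKN n] at this
    simp at this
    linarith
  have hlim : Tendsto (fun n => P.real (E n) - P.real (E (n + N))) atTop (nhds (e - e)) :=
    htend.sub (htend.comp (tendsto_add_atTop_nat N))
  have h0 : p ^ N * e ≤ e - e := ge_of_tendsto' hlim hle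
  rw [sub_self] at h0
  have he0 : e ≤ 0 := by
    by_contra hc
    push Not at hc
    have := mul_pos (pow_pos hp N) hc
    linarith
  have : e = 0 := le_antisymm he0 measureReal_nonneg
  exact (measureReal_eq_zero_iff).1 this

lemma gk_nonneg (v : ℝ) (hv : 0 ≤ v) (A : Set ℝ) : 0 ≤ gk v A := by
  unfold gk
  have : 0 ≤ 2 * Real.pi * v := by have := Real.pi_pos; positivity
  exact mul_nonneg (Real.rpow_nonneg this _) (integral_nonneg fun x => (Real.exp_pos _).le)

/-- The deterministic part: no long run of bad times with all outputs in the tame set. -/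
lemma lem_run (b L P₀ : ℝ) (hb : b < 4) (hL : 0 < L) (hP₀ : 0 < P₀) :
    ∃ N : ℕ, ∀ M : ℝ, 2 ≤ M → 2 * L ^ 2 * P₀ ≤ M → ∀ (R s w z : ℕ → ℝ),
      (∀ i, P₀⁻¹ ≤ R i) → (∀ i, s i = R (i + 1) / R i) →
      (∀ i, R (i + 1) = R i + w i ^ 2) →
      (∀ i ≤ N, M < s i) →
      (∀ i < N, |w (i + 1)| < L * |z i| ^ b ∧ 1 ≤ |z i| ∧ |z i| ≤ Real.sqrt (s i)) → False := by
  obtain ⟨N, hN⟩ := lem_det (max b 1) (lt_of_lt_of_le one_pos (le_max_right _ _))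
    (max_lt hb (by norm_num))
  refine ⟨N, fun M hM2 hML R s w z hR hs hRw hbad hgood => ?_⟩
  have hPi : 0 < P₀⁻¹ := inv_pos.2 hP₀
  have hR0 : ∀ i, 0 < R i := fun i => hPi.trans_le (hR i)
  have hRs : ∀ i, R (i + 1) = R i * s i := fun i => by
    rw [hs]; field_simp [(hR0 i).ne']
  have hs0 : ∀ i, 0 < s i := fun i => by rw [hs]; exact div_pos (hR0 _) (hR0 _)
  refine hN (fun i => Real.log (R (i + 1)) - Real.log (2 * L ^ 2)) (fun i => Real.log (s i))
    ?_ ?_ ?_ ?_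
  · intro i hi
    exact Real.log_pos (by linarith [hbad i hi])
  · simp only [sub_nonneg]
    apply Real.log_le_log (by positivity)
    rw [hRs]
    have h1 := hbad 0 (Nat.zero_le _)
    calc 2 * L ^ 2 = P₀⁻¹ * (2 * L ^ 2 * P₀) := by field_simp
      _ ≤ R 0 * s 0 := by
        refine mul_le_mul (hR 0) (by linarith) (by positivity) (hR0 0).le
  · intro i hi
    rw [hRs (i + 1), Real.log_mul (hR0 _).ne' (hs0 _).ne']
    ring
  · intro i hi
    obtain ⟨g1, g2, g3⟩ := hgood i hi
    have hz0 : 0 < |z i| := by linarith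
    have hw : |w (i + 1)| ≤ L * Real.sqrt (s i) ^ (max b 1) := by
      refine g1.le.trans (mul_le_mul_of_nonneg_left ?_ hL.le)
      exact (Real.rpow_le_rpow_of_exponent_le g2 (le_max_left _ _)).trans
        (Real.rpow_le_rpow hz0.le g3 (zero_le_one.trans (le_max_right _ _)))
    have hw2 : w (i + 1) ^ 2 ≤ L ^ 2 * s i ^ (max b 1) := by
      rw [← sq_abs]
      refine (pow_le_pow_left₀ (abs_nonneg _) hw 2).trans (le_of_eq ?_)
      rw [mul_pow, ← Real.rpow_natCast (_ ^ _) 2, ← Real.rpow_mul (Real.sqrt_nonneg _),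
        mul_comm (max b 1), Real.rpow_mul (Real.sqrt_nonneg _), Real.rpow_natCast, Real.sq_sqrt (hs0 i).le]
    have hb1 := hbad (i + 1) (by omega)
    have h1 : s (i + 1) * R (i + 1) ≤ 2 * L ^ 2 * s i ^ (max b 1) := by
      have e1 : R (i + 1) * s (i + 1) = R (i + 1) + w (i + 1) ^ 2 := by rw [← hRs, hRw (i + 1)]
      nlinarith [hR0 (i + 1)]
    have h2 := Real.log_le_log (mul_pos (hs0 _) (hR0 _)) h1
    rw [Real.log_mul (hs0 _).ne' (hR0 _).ne',
      Real.log_mul (by positivity) (Real.rpow_pos_of_pos (hs0 i) _).ne',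
      Real.log_rpow (hs0 i)] at h2
    linarith

theorem stmt_15
    {Ω : Type*} [MeasurableSpace Ω] (P : Measure Ω) [IsProbabilityMeasure P]
    (y : ℕ → Ω → ℝ) (hy : ∀ t, Measurable (y t))
    (f : ℝ → ℝ) (hf : Measurable f)
    (P₀ : ℝ) (hP₀ : 0 < P₀)
    (R σ2 : ℕ → Ω → ℝ)
    (hR : ∀ t ω, R t ω = P₀⁻¹ + ∑ i ∈ Finset.range t, (f (y i ω)) ^ 2)
    (hσ2 : ∀ t ω, σ2 t ω = R (t + 1) ω / R t ω)
    (𝔉 : ℕ → MeasurableSpace Ω)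
    (h𝔉 : ∀ t, 𝔉 t = ⨆ i : Fin (t + 1), MeasurableSpace.comap (y i) inferInstance)
    (hGauss : ∀ t : ℕ, ∀ A : Set ℝ, MeasurableSet A →
      (P[Set.indicator {ω | y (t + 1) ω ∈ A} (fun _ => (1 : ℝ))|𝔉 t]) =ᵐ[P]
        fun ω => (2 * Real.pi * σ2 t ω) ^ (-(1 : ℝ) / 2) *
          ∫ x in A, Real.exp (-x ^ 2 / (2 * σ2 t ω)))
    (k₁ k₂ : ℝ) (hk₁ : 0 < k₁) (hk₂ : 0 < k₂)
    (hfgrow : ∀ x : ℝ, |f x| ≤ k₁ * Real.exp (k₂ * |x|))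
    (hpos : 0 < volume {x : ℝ | 0 < |f x|})
    (b L : ℝ) (hb : b < 4) (hL : 0 < L)
    (hint : ∃ u v : ℝ, u < v ∧ Set.Ioo u v ⊆ {x : ℝ | |f x| < L * |x| ^ b})
    (hliminf : 0 < Filter.liminf (fun l : ℝ =>
      (volume ({x : ℝ | |f x| < L * |x| ^ b} ∩ Set.Icc (-l) l)).toReal / l)
      Filter.atTop) :
    ∀ᵐ ω ∂P, BddAbove (Set.range fun t => Real.sqrt (σ2 t ω)) := by
  -- measurability
  have hm : ∀ t, 𝔉 t ≤ ‹MeasurableSpace Ω› := fun t => by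
    rw [h𝔉]; exact iSup_le fun i => (hy i).comap_le
  have hyF : ∀ t i, i ≤ t → Measurable[𝔉 t] (y i) := fun t i hi => by
    rw [h𝔉]
    exact (comap_measurable (y i)).mono
      (le_iSup (fun i : Fin (t + 1) => MeasurableSpace.comap (y i) inferInstance)
        ⟨i, by omega⟩) le_rfl
  have hmono : Monotone 𝔉 := by
    intro s t hst
    rw [h𝔉 s]
    exact iSup_le fun i => (hyF t i (by have := i.2; omega)).comap_le
  have hRF : ∀ t s, s ≤ t + 1 → Measurable[𝔉 t] (R s) := fun t s hs => by
    have : R s = fun ω => P₀⁻¹ + ∑ i ∈ Finset.range s, (f (y i ω)) ^ 2 := funext (hR s)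
    rw [this]
    refine Measurable.const_add ?_ _
    refine Finset.measurable_fun_sum _ fun i hi => ?_
    exact (hf.comp (hyF t i (by have := Finset.mem_range.1 hi; omega))).pow_const 2
  have hσF : ∀ t, Measurable[𝔉 t] (σ2 t) := fun t => by
    have : σ2 t = fun ω => R (t + 1) ω / R t ω := funext (hσ2 t)
    rw [this]
    exact (hRF t (t + 1) le_rfl).div (hRF t t (by omega))
  -- elementary facts
  have hPi : 0 < P₀⁻¹ := inv_pos.2 hP₀
  have hRge : ∀ t ω, P₀⁻¹ ≤ R t ω := fun t ω => by
    rw [hR]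
    have : 0 ≤ ∑ i ∈ Finset.range t, (f (y i ω)) ^ 2 := Finset.sum_nonneg fun i _ => sq_nonneg _
    linarith
  have hR0 : ∀ t ω, 0 < R t ω := fun t ω => hPi.trans_le (hRge t ω)
  have hRs : ∀ t ω, R (t + 1) ω = R t ω + f (y t ω) ^ 2 := fun t ω => by
    rw [hR, hR, Finset.sum_range_succ]; ring
  have hσ1 : ∀ t ω, 1 ≤ σ2 t ω := fun t ω => by
    rw [hσ2, le_div_iff₀ (hR0 _ _), hRs]; nlinarith [sq_nonneg (f (y t ω))]
  have hker : ∀ t (A : ℕ → Set ℝ), (∀ k, MeasurableSet (A k)) → ∀ κ : Ω → ℕ, Measurable[𝔉 t] κ →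
      ∀ g : Ω → ENNReal, Measurable[𝔉 t] g →
      ∫⁻ ω, g ω * Set.indicator {ω | y (t + 1) ω ∈ A (κ ω)} (fun _ => (1 : ENNReal)) ω ∂P
      = ∫⁻ ω, g ω * ENNReal.ofReal (gk (σ2 t ω) (A (κ ω))) ∂P := by
    intro t A hA κ hκ g hg
    exact lem_kappa (hm t) P (y (t + 1)) (hy _) A hA (fun k ω => gk (σ2 t ω) (A k))
      (fun k ω => gk_nonneg _ (zero_le_one.trans (hσ1 t ω)) _) (fun k => hGauss t _ (hA k)) κ hκ g hg
  -- constants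
  set S : Set ℝ := {x : ℝ | |f x| < L * |x| ^ b} with hS
  have hSm : MeasurableSet S :=
    measurableSet_lt hf.abs ((measurable_id.abs.pow_const b).const_mul L)
  obtain ⟨M₀, p, hM₀, hp, hp1, hdens⟩ := lem_dens S hSm hliminf
  obtain ⟨N, hN⟩ := lem_run b L P₀ hb hL hP₀
  obtain ⟨δ, hδ, hlow⟩ := lem_lower f hf hpos
  set M := max M₀ (max 2 (2 * L ^ 2 * P₀)) with hMdef
  have hMM₀ : M₀ ≤ M := le_max_left _ _
  have hM2 : 2 ≤ M := (le_max_left _ _).trans (le_max_right _ _)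
  have hML : 2 * L ^ 2 * P₀ ≤ M := (le_max_right _ _).trans (le_max_right _ _)
  obtain ⟨q, hq, hlowM⟩ := hlow M (by linarith)
  obtain ⟨K, hK, hup⟩ := lem_upper f hf k₁ k₂ hk₁ hk₂ hfgrow M (M - 1) (by linarith) (by linarith)
  -- recurrence to the good set
  have hrec : ∀ᵐ ω ∂P, ∃ᶠ t in atTop, ω ∉ {ω | M < σ2 t ω} := by
    set A : ℕ → Set ℝ := fun k => S ∩ {x | 1 ≤ |x| ∧ |x| ≤ (k : ℝ)} with hA
    have hAm : ∀ k, MeasurableSet (A k) := fun k => hSm.inter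
      ((measurableSet_le measurable_const measurable_id.abs).inter
        (measurableSet_le measurable_id.abs measurable_const))
    set κ : ℕ → Ω → ℕ := fun t ω => ⌊Real.sqrt (σ2 t ω)⌋₊ with hκ
    have hκm : ∀ t, Measurable[𝔉 t] (κ t) := fun t =>
      Nat.measurable_floor.comp (Real.continuous_sqrt.measurable.comp (hσF t))
    have hHm : ∀ t, MeasurableSet[𝔉 (t + 1)] {ω | y (t + 1) ω ∈ A (κ t ω)} := by
      intro t
      have : {ω | y (t + 1) ω ∈ A (κ t ω)} = ⋃ k, (κ t ⁻¹' {k} ∩ y (t + 1) ⁻¹' (A k)) := by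
        ext ω; simp
      rw [this]
      exact MeasurableSet.iUnion fun k => (hmono (Nat.le_succ t) _
        (hκm t (measurableSet_singleton k))).inter (hyF (t + 1) (t + 1) le_rfl (hAm k))
    refine lem_rec P 𝔉 hm hmono (fun t => {ω | M < σ2 t ω})
      (fun t => {ω | y (t + 1) ω ∈ A (κ t ω)}) (fun t => ?_) hHm p hp hp1 ?_ N ?_
    · exact hσF t measurableSet_Ioi
    · intro t D hD hDB
      have h1 := hker t A hAm (κ t) (hκm t) (D.indicator fun _ => 1) (measurable_const.indicator hD)
      have hDm := hm t _ hD
      have e1 : ∫⁻ ω, D.indicator (fun _ => (1 : ENNReal)) ω *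
          Set.indicator {ω | y (t + 1) ω ∈ A (κ t ω)} (fun _ => (1 : ENNReal)) ω ∂P
          = P (D ∩ {ω | y (t + 1) ω ∈ A (κ t ω)}) := by
        rw [← lintegral_indicator_one (hDm.inter (hm _ _ (hHm t)))]
        refine lintegral_congr fun ω => ?_
        rw [Set.inter_indicator_one]; rfl
      have e2 : ENNReal.ofReal p * P D ≤ ∫⁻ ω, D.indicator (fun _ => (1 : ENNReal)) ω *
          ENNReal.ofReal (gk (σ2 t ω) (A (κ t ω))) ∂P := by
        rw [← lintegral_indicator_const hDm]
        refine lintegral_mono fun ω => ?_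
        by_cases hω : ω ∈ D
        · simp only [Set.indicator_of_mem hω, one_mul]
          exact ENNReal.ofReal_le_ofReal (hdens _ (lt_of_le_of_lt hMM₀ (hDB hω)))
        · simp [hω]
      rw [← h1, e1] at e2
      have := ENNReal.toReal_mono (measure_ne_top _ _) e2
      rwa [ENNReal.toReal_mul, ENNReal.toReal_ofReal hp.le] at this
    · intro n ω hbad hgood
      refine hN M hM2 hML (fun i => R (n + i) ω) (fun i => σ2 (n + i) ω)
        (fun i => f (y (n + i) ω)) (fun i => y (n + i + 1) ω) (fun i => hRge _ _)
        (fun i => hσ2 _ _) (fun i => hRs _ _) hbad fun i hi => ?_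
      have := hgood i hi
      exact ⟨this.1, this.2.1, this.2.2.trans (Nat.floor_le (Real.sqrt_nonneg _))⟩
  -- eventually, good times are followed by good times
  have hstay : ∀ᵐ ω ∂P, ∀ᶠ t in atTop, ω ∉ {ω | σ2 t ω ≤ M ∧ M < σ2 (t + 1) ω} := by
    apply ae_eventually_notMem
    have hgoodm : ∀ t, MeasurableSet[𝔉 t] {ω | σ2 t ω ≤ M} := fun t => hσF t measurableSet_Iic
    set g : ℕ → Ω → ENNReal := fun t => {ω | σ2 t ω ≤ M}.indicator
      (fun ω => ENNReal.ofReal (1 / R (t + 1) ω ^ 2)) with hg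
    have hgm : ∀ t, Measurable[𝔉 t] (g t) := fun t =>
      (((hRF t (t + 1) le_rfl).pow_const 2).const_div 1).ennreal_ofReal.indicator (hgoodm t)
    have hc : 0 < M - 1 := by linarith
    -- tail bound
    have h1 : ∀ t, P {ω | σ2 t ω ≤ M ∧ M < σ2 (t + 1) ω} ≤ ENNReal.ofReal K * ∫⁻ ω, g t ω ∂P := by
      intro t
      set A : ℕ → Set ℝ := fun k => {x | (M - 1) * ((k : ℝ) + 1) ≤ f x ^ 2 + (M - 1)} with hA
      have hAm : ∀ k, MeasurableSet (A k) := fun k =>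
        measurableSet_le measurable_const ((hf.pow_const 2).add_const _)
      have hκm : Measurable[𝔉 t] (fun ω => ⌊R (t + 1) ω⌋₊) :=
        Nat.measurable_floor.comp (hRF t (t + 1) le_rfl)
      have h2 := hker t A hAm _ hκm ({ω | σ2 t ω ≤ M}.indicator fun _ => 1)
        (measurable_const.indicator (hgoodm t))
      have hEm : MeasurableSet {ω | σ2 t ω ≤ M ∧ M < σ2 (t + 1) ω} :=
        (hm _ _ (hgoodm t)).inter (hm _ _ (hσF (t + 1) measurableSet_Ioi))
      rw [← lintegral_indicator_one hEm]
      rw [← lintegral_const_mul _ ((hgm t).mono (hm t) le_rfl)]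
      calc _ ≤ _ := ?_
        _ = _ := h2
        _ ≤ _ := ?_
      · refine lintegral_mono fun ω => ?_
        by_cases hω : ω ∈ {ω | σ2 t ω ≤ M ∧ M < σ2 (t + 1) ω}
        · have hω1 : ω ∈ {ω | σ2 t ω ≤ M} := hω.1
          have hω2 : ω ∈ {ω | y (t + 1) ω ∈ A ⌊R (t + 1) ω⌋₊} := by
            have h3 := hω.2
            rw [hσ2, lt_div_iff₀ (hR0 _ _), hRs (t + 1)] at h3
            have h4 := Nat.floor_le (hR0 (t + 1) ω).le
            change (M - 1) * ((⌊R (t + 1) ω⌋₊ : ℝ) + 1) ≤ f (y (t + 1) ω) ^ 2 + (M - 1)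
            nlinarith
          rw [Set.indicator_of_mem hω, Set.indicator_of_mem hω1, Set.indicator_of_mem hω2]
          simp
        · rw [Set.indicator_of_notMem hω]; exact zero_le
      · refine lintegral_mono fun ω => ?_
        by_cases hω : ω ∈ {ω | σ2 t ω ≤ M}
        · simp only [hg, Set.indicator_of_mem hω, one_mul]
          rw [← ENNReal.ofReal_mul hK.le]
          refine ENNReal.ofReal_le_ofReal ((hup _ (hσ1 t ω) hω _).trans ?_)
          rw [mul_one_div]
          have := (Nat.lt_floor_add_one (R (t + 1) ω)).le
          have := hR0 (t + 1) ω
          gcongr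
        · simp [Set.indicator_of_notMem hω]
    -- telescoping
    set cc := δ ^ 2 / (1 + δ ^ 2 * P₀) with hcc
    have hcc0 : 0 < cc := by positivity
    set u : ℕ → Ω → ℝ := fun t ω => 1 / R (t + 1) ω - 1 / R (t + 2) ω with hu
    have hu0 : ∀ t ω, 0 ≤ u t ω := fun t ω => by
      simp only [hu, sub_nonneg]
      apply one_div_le_one_div_of_le (hR0 _ _)
      rw [hRs (t + 1)]; nlinarith [sq_nonneg (f (y (t + 1) ω))]
    have hum : ∀ t, Measurable (u t) := fun t =>
      (((hRF t (t + 1) le_rfl).mono (hm t) le_rfl).const_div 1).sub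
        (((hRF (t + 1) (t + 2) le_rfl).mono (hm (t + 1)) le_rfl).const_div 1)
    have h2 : ∀ t, ENNReal.ofReal (cc * q) * ∫⁻ ω, g t ω ∂P
        ≤ ∫⁻ ω, ENNReal.ofReal (u t ω) ∂P := by
      intro t
      have h3 := hker t (fun _ => {x | δ < |f x|})
        (fun _ => measurableSet_lt measurable_const hf.abs) (fun _ => 0) measurable_const
        (fun ω => ENNReal.ofReal cc * g t ω) ((hgm t).const_mul _)
      rw [← lintegral_const_mul _ ((hgm t).mono (hm t) le_rfl)]
      calc _ ≤ _ := ?_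
        _ = _ := h3.symm
        _ ≤ _ := ?_
      · refine lintegral_mono fun ω => ?_
        by_cases hω : ω ∈ {ω | σ2 t ω ≤ M}
        · rw [ENNReal.ofReal_mul hcc0.le, mul_right_comm]
          gcongr
          exact hlowM _ (hσ1 t ω) hω
        · simp [hg, Set.indicator_of_notMem hω]
      · refine lintegral_mono fun ω => ?_
        by_cases hω : ω ∈ {ω | σ2 t ω ≤ M}
        · by_cases hω2 : ω ∈ {ω | y (t + 1) ω ∈ {x | δ < |f x|}}
          · rw [Set.indicator_of_mem hω2]
            simp only [hg, Set.indicator_of_mem hω, mul_one]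
            rw [← ENNReal.ofReal_mul hcc0.le]
            apply ENNReal.ofReal_le_ofReal
            have hr := hR0 (t + 1) ω
            have hr2 := hRge (t + 1) ω
            have hfd : δ ^ 2 ≤ f (y (t + 1) ω) ^ 2 := by
              rw [← sq_abs (f _)]; exact pow_le_pow_left₀ hδ.le (le_of_lt hω2) 2
            have hr3 : R (t + 1) ω + δ ^ 2 ≤ R (t + 2) ω := by
              rw [hRs (t + 1)]; linarith
            have hr4 : 1 ≤ R (t + 1) ω * P₀ := by
              rwa [inv_le_iff_one_le_mul₀ hP₀] at hr2
            have h5 : 1 / R (t + 2) ω ≤ 1 / (R (t + 1) ω + δ ^ 2) :=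
              one_div_le_one_div_of_le (by positivity) hr3
            have h6 : cc * (1 / R (t + 1) ω ^ 2) ≤ 1 / R (t + 1) ω - 1 / (R (t + 1) ω + δ ^ 2) := by
              have e : 1 / R (t + 1) ω - 1 / (R (t + 1) ω + δ ^ 2)
                  = δ ^ 2 / (R (t + 1) ω * (R (t + 1) ω + δ ^ 2)) := by
                field_simp; ring
              rw [e, hcc, div_mul_div_comm, mul_one]
              apply div_le_div_of_nonneg_left (by positivity) (by positivity)
              have : δ ^ 2 ≤ δ ^ 2 * (R (t + 1) ω * P₀) := le_mul_of_one_le_right (by positivity) hr4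
              nlinarith
            simp only [hu]
            linarith
          · rw [Set.indicator_of_notMem hω2]; simp
        · simp [hg, Set.indicator_of_notMem hω]
    have h3 : ∑' t, ∫⁻ ω, ENNReal.ofReal (u t ω) ∂P ≤ ENNReal.ofReal P₀ := by
      rw [← lintegral_tsum fun t => (hum t).ennreal_ofReal.aemeasurable]
      have : ∀ ω, ∑' t, ENNReal.ofReal (u t ω) ≤ ENNReal.ofReal P₀ := by
        intro ω
        refine ENNReal.tsum_le_of_sum_range_le fun n => ?_
        rw [← ENNReal.ofReal_sum_of_nonneg fun i _ => hu0 i ω]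
        apply ENNReal.ofReal_le_ofReal
        have e := Finset.sum_range_sub' (fun t => 1 / R (t + 1) ω) n
        simp only [hu]
        refine (le_of_eq e).trans ?_
        have e1 : 1 / R (0 + 1) ω ≤ P₀ := by
          have := one_div_le_one_div_of_le hPi (hRge (0 + 1) ω)
          simpa using this
        have e2 : 0 ≤ 1 / R (n + 1) ω := by have := hR0 (n + 1) ω; positivity
        linarith
      calc _ ≤ ∫⁻ _, ENNReal.ofReal P₀ ∂P := lintegral_mono this
        _ = _ := by simp
    have hcq : ENNReal.ofReal (cc * q) ≠ 0 := by
      have := mul_pos hcc0 hq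
      simpa using this
    have h4 : ∑' t, ∫⁻ ω, g t ω ∂P ≠ ⊤ := by
      have h5 : ENNReal.ofReal (cc * q) * ∑' t, ∫⁻ ω, g t ω ∂P ≤ ENNReal.ofReal P₀ := by
        rw [← ENNReal.tsum_mul_left]
        exact (ENNReal.tsum_le_tsum h2).trans h3
      intro htop
      rw [htop, ENNReal.mul_top hcq] at h5
      exact absurd h5 (by simp)
    have h5 : ∑' t, P {ω | σ2 t ω ≤ M ∧ M < σ2 (t + 1) ω}
        ≤ ENNReal.ofReal K * ∑' t, ∫⁻ ω, g t ω ∂P := by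
      rw [← ENNReal.tsum_mul_left]
      exact ENNReal.tsum_le_tsum h1
    exact ne_top_of_le_ne_top (ENNReal.mul_ne_top ENNReal.ofReal_ne_top h4) h5
  filter_upwards [hrec, hstay] with ω h1 h2
  obtain ⟨T, hT⟩ := eventually_atTop.1 h2
  obtain ⟨t₀, ht₀, hgood⟩ := frequently_atTop.1 h1 T
  have hall : ∀ t, t₀ ≤ t → σ2 t ω ≤ M := by
    intro t ht
    induction t, ht using Nat.le_induction with
    | base => exact not_lt.1 hgood
    | succ t ht ih =>
      by_contra hcon
      exact hT t (ht₀.trans ht) ⟨ih, not_le.1 hcon⟩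
  refine ⟨Real.sqrt M + ∑ i ∈ Finset.range t₀, Real.sqrt (σ2 i ω), ?_⟩
  rintro _ ⟨t, rfl⟩
  simp only
  have hsum0 : ∀ i ∈ Finset.range t₀, 0 ≤ Real.sqrt (σ2 i ω) := fun i _ => Real.sqrt_nonneg _
  by_cases ht : t₀ ≤ t
  · have := Real.sqrt_le_sqrt (hall t ht)
    have := Finset.sum_nonneg hsum0
    linarith
  · have := Finset.single_le_sum hsum0 (Finset.mem_range.2 (not_le.1 ht))
    have := Real.sqrt_nonneg M
    linarith
end

section
/- In the closed-loop least-squares setup, suppose a ≥ 4, |f(x)| ≤ γ₁ + γ₂·|x|^a for all x ∈ ℝ and some γ₁, γ₂ > 0, and the set {x ∈ ℝ : |f(x)| > 0} has positive Lebesgue measure. Let x_min = ((a−2) − √((a−2)² − 4))/2 be the smallest real solution of x² − (a−2)x + 1 = 0, and define the events D₁ := {sup_t σ_t = +∞} and D₂ := {liminf_{t→+∞} (log r_t)/(log r_{t−1}) ≥ 1 + x_min}. Then D₁ = D₂ up to a null set, i.e. P(D₁ Δ D₂) = 0. -/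
open MeasureTheory ProbabilityTheory Filter

lemma det1_step (R : ℕ → ℝ) (hpos : ∀ t, 0 < R t) (a η : ℝ) (t : ℕ)
    (h : R (t+2) ≤ R (t+1) + (R (t+1) / R t) ^ a * R (t+1) ^ η) :
    Real.log (R (t+2)) - Real.log (R (t+1)) ≤ Real.log 2 +
      max 0 (a * (Real.log (R (t+1)) - Real.log (R t)) + (η - 1) * Real.log (R (t+1))) := by
  set z := a * (Real.log (R (t+1)) - Real.log (R t)) + (η - 1) * Real.log (R (t+1)) with hz
  have h1 := hpos (t+1)
  have h0 := hpos t
  have e : (R (t+1) / R t) ^ a * R (t+1) ^ η = R (t+1) * Real.exp z := by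
    rw [Real.rpow_def_of_pos (div_pos h1 h0), Real.rpow_def_of_pos h1,
      Real.log_div h1.ne' h0.ne', ← Real.exp_add]
    have e2 : R (t+1) * Real.exp z = Real.exp (Real.log (R (t+1)) + z) := by
      rw [Real.exp_add (Real.log (R (t+1))) z, Real.exp_log h1]
    rw [e2, hz]
    congr 1; ring
  have h2 : R (t+2) ≤ R (t+1) * (2 * Real.exp (max 0 z)) := by
    have a1 : (1:ℝ) ≤ Real.exp (max 0 z) := Real.one_le_exp (le_max_left _ _)
    have a2 : Real.exp z ≤ Real.exp (max 0 z) := Real.exp_le_exp.2 (le_max_right _ _)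
    rw [e] at h
    nlinarith
  have h3 := Real.log_le_log (hpos (t+2)) h2
  rw [Real.log_mul h1.ne' (by positivity), Real.log_mul (by norm_num) (by positivity),
    Real.log_exp] at h3
  linarith

lemma det1 (R : ℕ → ℝ) (hpos : ∀ t, 0 < R t) (hmono : ∀ t, R t ≤ R (t+1))
    (hlim : Tendsto R atTop atTop) (a : ℝ) (ha : 4 ≤ a)
    (hstep : ∀ η : ℝ, 0 < η → ∀ᶠ t in atTop,
      R (t+2) ≤ R (t+1) + (R (t+1) / R t) ^ a * R (t+1) ^ η)
    (δ x : ℝ) (hx : x ^ 2 - (a - 2) * x + 1 = 0) (hx0 : 0 < x) (hxa : x ≤ (a - 2) / 2)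
    (hδ : δ < x)
    (hfreq : ∃ᶠ t in atTop, Real.log (R (t+1)) / Real.log (R t) < 1 + δ) :
    ∃ C, ∀ᶠ t in atTop, R (t+1) / R t ≤ C := by
  obtain ⟨δ', hδδ, hδx, hδ2⟩ : ∃ δ' : ℝ, δ ≤ δ' ∧ δ' < x ∧ x / 2 ≤ δ' :=
    ⟨max δ (x/2), le_max_left _ _, max_lt hδ (by linarith), le_max_right _ _⟩
  have hx1 : x ≤ 1 := by nlinarith
  obtain ⟨η, hη0, hη1, hη2, hη3⟩ : ∃ η : ℝ, 0 < η ∧ 6 * η ≤ (x - δ') ^ 2 ∧ (a + 1) * η ≤ 1 ∧ η ≤ δ' := by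
    have : 0 < (x - δ') ^ 2 := by have : 0 < x - δ' := by linarith
                                  positivity
    refine ⟨min ((x - δ') ^ 2 / 6) (min (1 / (a + 1)) δ'), ?_, ?_, ?_, ?_⟩
    · refine lt_min (by linarith) (lt_min (by apply div_pos <;> linarith) (by linarith))
    · have := min_le_left ((x - δ') ^ 2 / 6) (min (1 / (a + 1)) δ')
      linarith
    · have h := (min_le_right ((x - δ') ^ 2 / 6) (min (1 / (a + 1)) δ')).trans (min_le_left _ _)
      have h' := mul_le_mul_of_nonneg_left h (by linarith : (0:ℝ) ≤ a + 1)
      rwa [mul_one_div_cancel (by linarith : a + 1 ≠ 0)] at h'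
    · exact (min_le_right ((x - δ') ^ 2 / 6) (min (1 / (a + 1)) δ')).trans (min_le_right _ _)
  have hLlim : Tendsto (fun t => Real.log (R t)) atTop atTop := Real.tendsto_log_atTop.comp hlim
  have hev := (hstep η hη0).and (hLlim.eventually_ge_atTop (Real.log 2 / η))
  obtain ⟨T0, hT0⟩ := eventually_atTop.1 hev
  have hLbig : ∀ t, T0 ≤ t → Real.log 2 ≤ η * Real.log (R t) := by
    intro t ht
    have := (hT0 t ht).2
    rw [div_le_iff₀ hη0] at this
    linarith
  have hL0 : ∀ t, T0 ≤ t → 0 < Real.log (R t) := by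
    intro t ht
    have := hLbig t ht
    have h2 := Real.log_pos (by norm_num : (1:ℝ) < 2)
    by_contra hc
    nlinarith
  have hd0 : ∀ t, 0 ≤ Real.log (R (t+1)) - Real.log (R t) := fun t =>
    sub_nonneg.2 (Real.log_le_log (hpos t) (hmono t))
  have key : ∀ t, T0 ≤ t → ∀ w, 0 ≤ w → w ≤ δ' →
      Real.log (R (t+1)) - Real.log (R t) ≤ w * Real.log (R t) →
      Real.log (R (t+2)) - Real.log (R (t+1)) ≤ max η (w - η) * Real.log (R (t+1)) := by
    intro t ht w hw0 hw1 hd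
    have h := det1_step R hpos a η t (hT0 t ht).1
    have hl1 := hLbig (t+1) (by omega)
    have hp1 := hL0 (t+1) (by omega)
    have hp0 := hL0 t ht
    have hdd := hd0 t
    generalize Real.log (R (t+2)) = L2 at *
    set L1 := Real.log (R (t+1))
    set L0 := Real.log (R t)
    rcases le_total 0 (a * (L1 - L0) + (η - 1) * L1) with hc | hc
    · rw [max_eq_right hc] at h
      have hq : 3 * η * (1 + w) ≤ w ^ 2 - (a - 2) * w + 1 := by
        have e1 : w ^ 2 - (a - 2) * w + 1 = (x - w) * ((a - 2) - x - w) := by linarith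
        have e2 : (x - δ') ^ 2 ≤ (x - w) * ((a - 2) - x - w) := by
          rw [sq]; apply mul_le_mul <;> linarith
        nlinarith
      have hq2 : (a - 1 - w + 3 * η) * (L1 - L0) ≤ (1 + w - 3 * η) * L0 := by
        have : (a - 1 - w + 3 * η) * (L1 - L0) ≤ (a - 1 - w + 3 * η) * (w * L0) :=
          mul_le_mul_of_nonneg_left hd (by linarith)
        nlinarith
      have : (w - η) * L1 ≤ max η (w - η) * L1 :=
        mul_le_mul_of_nonneg_right (le_max_right _ _) hp1.le
      nlinarith
    · rw [max_eq_left hc] at h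
      have : η * L1 ≤ max η (w - η) * L1 :=
        mul_le_mul_of_nonneg_right (le_max_left _ _) hp1.le
      linarith
  obtain ⟨T, hT, hTf⟩ := frequently_atTop.1 hfreq T0
  have ind : ∀ n : ℕ, Real.log (R (T+n+1)) - Real.log (R (T+n)) ≤
      max η (δ' - n * η) * Real.log (R (T+n)) := by
    intro n
    induction n with
    | zero =>
      have hp := hL0 T hT
      rw [div_lt_iff₀ hp] at hTf
      simp only [Nat.cast_zero, zero_mul, sub_zero, add_zero]
      rw [max_eq_right hη3]
      nlinarith
    | succ n ih =>
      have := key (T+n) (by omega) _ (le_max_of_le_left hη0.le)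
        (max_le hη3 (by have : 0 ≤ (n:ℝ) * η := by positivity
                        linarith)) ih
      refine this.trans (mul_le_mul_of_nonneg_right ?_ (hL0 _ (by omega)).le)
      push_cast
      refine max_le (le_max_left _ _) ?_
      rcases le_total η (δ' - n * η) with hc | hc
      · rw [max_eq_right hc]; apply le_max_of_le_right; linarith
      · rw [max_eq_left hc]; apply le_max_of_le_left; linarith
  obtain ⟨N, hN⟩ := exists_nat_ge (δ' / η)
  refine ⟨2, eventually_atTop.2 ⟨T + N + 1, fun t ht => ?_⟩⟩
  obtain ⟨n, rfl, hn⟩ : ∃ n, t = T + n + 1 ∧ N ≤ n := ⟨t - T - 1, by omega, by omega⟩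
  have h1 := ind n
  have hnη : δ' ≤ n * η := by
    rw [div_le_iff₀ hη0] at hN
    have : (N:ℝ) ≤ n := by exact_mod_cast hn
    nlinarith
  rw [max_eq_left (by linarith)] at h1
  have h := det1_step R hpos a η (T+n) (hT0 _ (by omega)).1
  have hp1 := hL0 (T+n+1) (by omega)
  have hp0 := hL0 (T+n) (by omega)
  have hdd := hd0 (T+n)
  rw [max_eq_left] at h
  · rw [add_zero, ← Real.log_div (hpos _).ne' (hpos _).ne'] at h
    exact (Real.log_le_log_iff (div_pos (hpos _) (hpos _)) (by norm_num)).1 h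
  · nlinarith

lemma det2 (R : ℕ → ℝ) (hpos : ∀ t, 0 < R t) (hmono : ∀ t, R t ≤ R (t+1)) (x : ℝ) (hx0 : 0 < x)
    (hl : ((1 + x : ℝ) : EReal) ≤ Filter.liminf (fun t : ℕ =>
          ((Real.log (R (t + 1)) / Real.log (R t) : ℝ) : EReal)) Filter.atTop) :
    ¬ BddAbove (Set.range fun t => Real.sqrt (R (t+1) / R t)) := by
  have hm : Monotone R := monotone_nat_of_le_succ hmono
  have hev : ∀ᶠ t in atTop, 1 + x / 2 < Real.log (R (t + 1)) / Real.log (R t) := by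
    have : ((1 + x / 2 : ℝ) : EReal) < Filter.liminf (fun t : ℕ =>
          ((Real.log (R (t + 1)) / Real.log (R t) : ℝ) : EReal)) Filter.atTop :=
      lt_of_lt_of_le (by exact_mod_cast (by linarith)) hl
    filter_upwards [eventually_lt_of_lt_liminf this] with t ht
    exact_mod_cast ht
  obtain ⟨T, hT⟩ := eventually_atTop.1 hev
  -- logs are eventually positive
  have hLp : 0 < Real.log (R T) := by
    by_contra hc
    have h := hT T le_rfl
    have hle : Real.log (R T) ≤ Real.log (R (T+1)) := Real.log_le_log (hpos T) (hmono T)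
    rcases eq_or_lt_of_le (not_lt.1 hc) with h0 | h0
    · rw [h0, div_zero] at h; linarith
    · rw [lt_div_iff_of_neg h0] at h
      nlinarith
  have hLp' : ∀ t, T ≤ t → Real.log (R T) ≤ Real.log (R t) := fun t ht =>
    Real.log_le_log (hpos T) (hm ht)
  have hgrow : ∀ t, T ≤ t → (1 + x / 2) * Real.log (R t) < Real.log (R (t+1)) := by
    intro t ht
    have := hT t ht
    rwa [lt_div_iff₀ (hLp.trans_le (hLp' t ht))] at this
  have hlin : ∀ n : ℕ, Real.log (R T) + n * (x / 2 * Real.log (R T)) ≤ Real.log (R (T+n)) := by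
    intro n
    induction n with
    | zero => simp
    | succ n ih =>
      have := hgrow (T+n) (by omega)
      have h2 := hLp' (T+n) (by omega)
      push_cast
      rw [← add_assoc]
      nlinarith
  rintro ⟨C, hC⟩
  have hC' : ∀ t, Real.log (R (t+1)) - Real.log (R t) ≤ C ^ 2 := by
    intro t
    have h1 : Real.sqrt (R (t+1) / R t) ≤ C := hC ⟨t, rfl⟩
    have hdp := div_pos (hpos (t+1)) (hpos t)
    have h2 : R (t+1) / R t ≤ C ^ 2 := by
      rw [← Real.sq_sqrt hdp.le]
      exact pow_le_pow_left₀ (Real.sqrt_nonneg _) h1 2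
    rw [← Real.log_div (hpos _).ne' (hpos _).ne']
    have := Real.log_le_sub_one_of_pos hdp
    linarith
  obtain ⟨n, hn⟩ := exists_nat_gt (C ^ 2 / (x / 2 * (x / 2 * Real.log (R T))))
  rw [div_lt_iff₀ (by positivity)] at hn
  have h1 := hlin n
  have h2 := hgrow (T+n) (by omega)
  have h3 := hC' (T+n)
  have h4 := mul_le_mul_of_nonneg_left h1 (by linarith : 0 ≤ x / 2)
  nlinarith [mul_pos hx0 hLp]

lemma asym1 (c d a η : ℝ) (hη : 0 < η) :
    ∀ᶠ L : ℝ in atTop, c + d * L ^ a ≤ Real.exp (η * L) := by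
  have h1 : (fun L : ℝ => c + d * L ^ a) =o[atTop] fun L => Real.exp (η * L) := by
    refine Asymptotics.IsLittleO.add ?_ ?_
    · refine Asymptotics.isLittleO_const_left.2 (Or.inr ?_)
      refine tendsto_norm_atTop_atTop.comp ?_
      exact Real.tendsto_exp_atTop.comp (tendsto_id.const_mul_atTop hη)
    · exact (isLittleO_rpow_exp_pos_mul_atTop a hη).const_mul_left d
  filter_upwards [h1.bound (one_pos)] with L hL
  rw [one_mul, Real.norm_of_nonneg (Real.exp_pos _).le] at hL
  exact (le_abs_self _).trans hL

lemma step_of_bounds (f : ℝ → ℝ) (y R : ℕ → ℝ) (hpos : ∀ t, 0 < R t) (hmono : ∀ t, R t ≤ R (t+1))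
    (hlim : Tendsto R atTop atTop)
    (hrec : ∀ t, R (t+1) = R t + (f (y t)) ^ 2)
    (a γ₁ γ₂ : ℝ) (ha : 4 ≤ a) (hγ₁ : 0 < γ₁) (hγ₂ : 0 < γ₂)
    (hfgrow : ∀ x : ℝ, |f x| ≤ γ₁ + γ₂ * |x| ^ a)
    (h1 : ∀ᶠ t : ℕ in atTop, (y (t+1)) ^ 2 ≤ 16 * (R (t+1) / R t) * Real.log ((t:ℝ)+1))
    (h2 : ∀ᶠ t : ℕ in atTop, Real.sqrt ((t:ℝ)+1) ≤ R (t+1))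
    (η : ℝ) (hη : 0 < η) : ∀ᶠ t in atTop,
      R (t+2) ≤ R (t+1) + (R (t+1) / R t) ^ a * R (t+1) ^ η := by
  have hLlim : Tendsto (fun t => Real.log (R (t+1))) atTop atTop :=
    Real.tendsto_log_atTop.comp (hlim.comp (tendsto_add_atTop_nat 1))
  have h3 := hLlim.eventually (asym1 (2*γ₁^2) (2*γ₂^2*32^a) a η hη)
  filter_upwards [h1, h2, h3, hLlim.eventually_ge_atTop 0] with t h1 h2 h3 h4
  rw [hrec (t+1)]
  have hs : 1 ≤ R (t+1) / R t := by rw [one_le_div (hpos t)]; exact hmono t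
  set s := R (t+1) / R t
  set L := Real.log (R (t+1)) with hL
  have ht1 : (0:ℝ) < (t:ℝ) + 1 := by positivity
  have hlog : Real.log ((t:ℝ)+1) ≤ 2 * L := by
    have := Real.log_le_log (Real.sqrt_pos.2 ht1) h2
    rw [Real.log_sqrt ht1.le] at this
    linarith
  have hy2 : (y (t+1)) ^ 2 ≤ s * (32 * L) := by nlinarith
  have hfa : (f (y (t+1)))^2 ≤ 2*γ₁^2 + 2*γ₂^2*(|y (t+1)| ^ a)^2 := by
    have hh := hfgrow (y (t+1))
    have : (f (y (t+1)))^2 ≤ (γ₁ + γ₂ * |y (t+1)| ^ a)^2 := by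
      rw [← sq_abs]; exact pow_le_pow_left₀ (abs_nonneg _) hh 2
    nlinarith [sq_nonneg (γ₁ - γ₂ * |y (t+1)| ^ a)]
  have hya : (|y (t+1)| ^ a)^2 ≤ s ^ a * (32 ^ a * L ^ a) := by
    have : (|y (t+1)| ^ a)^2 = ((y (t+1))^2) ^ a := by
      rw [← sq_abs (y (t+1)), ← Real.rpow_natCast, ← Real.rpow_natCast, ← Real.rpow_mul (abs_nonneg _),
        ← Real.rpow_mul (abs_nonneg _), mul_comm]
    rw [this, ← Real.mul_rpow (by norm_num) h4, ← Real.mul_rpow (by linarith) (by linarith)]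
    exact Real.rpow_le_rpow (sq_nonneg _) hy2 (by linarith)
  have hsa : 1 ≤ s ^ a := Real.one_le_rpow hs (by linarith)
  have hRe : R (t+1) ^ η = Real.exp (η * L) := by
    rw [Real.rpow_def_of_pos (hpos _), mul_comm]
  rw [hRe]
  have := mul_le_mul_of_nonneg_left h3 (by linarith : 0 ≤ s ^ a)
  have h6 := mul_le_mul_of_nonneg_left hya (by positivity : 0 ≤ 2*γ₂^2)
  nlinarith [sq_nonneg γ₁]

lemma asym2 (e k C : ℝ) (he : 0 < e) (hk : 0 < k) :
    ∀ᶠ t : ℕ in atTop, Real.sqrt ((t:ℝ)+1) ≤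
      e * (k * (t - Real.log ((t:ℝ)+1) - C) - 2 * Real.log ((t:ℝ)+1)) := by
  have hs : (fun x : ℝ => Real.sqrt x) =o[atTop] fun x => x := by
    rw [Asymptotics.isLittleO_iff]
    intro c hc
    filter_upwards [eventually_ge_atTop (1 / c ^ 2), eventually_ge_atTop 0] with x h1 h0
    rw [Real.norm_of_nonneg (Real.sqrt_nonneg _), Real.norm_of_nonneg h0]
    rw [div_le_iff₀ (by positivity)] at h1
    apply Real.sqrt_le_iff.2 ⟨by positivity, by nlinarith⟩
  have hl : (fun x : ℝ => Real.log x) =o[atTop] fun x => x := Real.isLittleO_log_id_atTop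
  have hc : (fun x : ℝ => e * k * (C + 1)) =o[atTop] fun x : ℝ => x :=
    Asymptotics.isLittleO_const_left.2 (Or.inr (tendsto_norm_atTop_atTop.comp tendsto_id))
  have hall := (hs.add (hl.const_mul_left (e * k + 2 * e))).add hc
  have hb := hall.bound (by positivity : 0 < e * k)
  have ht : Tendsto (fun t : ℕ => (t:ℝ) + 1) atTop atTop :=
    tendsto_atTop_add_const_right _ _ tendsto_natCast_atTop_atTop
  filter_upwards [ht.eventually hb] with t h
  have hp : (0:ℝ) ≤ (t:ℝ) + 1 := by positivity
  rw [Real.norm_of_nonneg hp] at h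
  have := (le_abs_self _).trans h
  nlinarith

/-- deterministic growth -/
lemma growth_det (R : ℕ → ℝ) (N S : ℕ → ℝ) (hpos : ∀ t, 0 < R t) (hmono : ∀ t, R t ≤ R (t+1))
    (e κ : ℝ) (he : 0 < e) (hκ : 0 < κ)
    (hS : ∀ t, S t = ∑ i ∈ Finset.range t, κ / Real.sqrt (R (i+1) / R i))
    (hN : ∀ t, e * N t ≤ R (t+1))
    (hev : ∀ᶠ t : ℕ in atTop, S t / 2 - 2 * Real.log ((t:ℝ)+1) ≤ N t) :
    ∀ᶠ t : ℕ in atTop, Real.sqrt ((t:ℝ)+1) ≤ R (t+1) := by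
  have hSl : ∀ t : ℕ, κ * (t - (Real.log (R t) - Real.log (R 0)) / 2) ≤ S t := by
    intro t
    rw [hS]
    induction t with
    | zero => simp
    | succ n ih =>
      rw [Finset.sum_range_succ]
      have hd := div_pos (hpos (n+1)) (hpos n)
      have h1 : 1 - (Real.log (R (n+1)) - Real.log (R n)) / 2 ≤ 1 / Real.sqrt (R (n+1) / R n) := by
        have := Real.add_one_le_exp (-((Real.log (R (n+1)) - Real.log (R n)) / 2))
        have e1 : 1 / Real.sqrt (R (n+1) / R n) =
            Real.exp (-((Real.log (R (n+1)) - Real.log (R n)) / 2)) := by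
          rw [Real.exp_neg, one_div, ← Real.log_div (hpos _).ne' (hpos _).ne', ← Real.log_sqrt hd.le,
            Real.exp_log (Real.sqrt_pos.2 hd)]
        rw [e1]; linarith
      have h2 := mul_le_mul_of_nonneg_left h1 hκ.le
      rw [mul_one_div] at h2
      push_cast
      linarith
  filter_upwards [hev, asym2 e (κ/2) (-Real.log (R 0) / 2) he (by positivity)] with t h1 h2
  by_contra hc
  push Not at hc
  have hRt : R t ≤ Real.sqrt ((t:ℝ)+1) := (hmono t).trans hc.le
  have hp : (0:ℝ) < (t:ℝ) + 1 := by positivity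
  have hlog := Real.log_le_log (hpos t) hRt
  rw [Real.log_sqrt hp.le] at hlog
  have hl0 : 0 ≤ Real.log ((t:ℝ)+1) := Real.log_nonneg (by linarith [(Nat.cast_nonneg t : (0:ℝ) ≤ t)])
  have h3 := hN t
  have h4 := mul_le_mul_of_nonneg_left h1 he.le
  have h5 : κ / 2 * (t - Real.log ((t:ℝ)+1) - (-Real.log (R 0) / 2)) ≤ S t / 2 := by
    have := hSl t
    have h6 : κ * (t - Real.log ((t:ℝ)+1) - (-Real.log (R 0) / 2)) ≤
      κ * (t - (Real.log (R t) - Real.log (R 0)) / 2) := by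
      apply mul_le_mul_of_nonneg_left _ hκ.le
      linarith
    linarith
  have h7 := mul_le_mul_of_nonneg_left h5 he.le
  nlinarith

lemma tail_gauss (v M : ℝ) (hv : 0 < v) :
    (2 * Real.pi * v) ^ (-(1 : ℝ) / 2) * ∫ x in {x : ℝ | M < x ^ 2}, Real.exp (-x ^ 2 / (2 * v)) ≤
      2 * Real.exp (-M / (4 * v)) := by
  have hb : 0 < 1 / (4 * v) := by positivity
  have hi := (integrable_exp_neg_mul_sq hb).const_mul (Real.exp (-M / (4 * v)))
  have h1 : ∫ x in {x : ℝ | M < x ^ 2}, Real.exp (-x ^ 2 / (2 * v)) ≤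
      ∫ x in {x : ℝ | M < x ^ 2}, Real.exp (-M / (4 * v)) * Real.exp (-(1 / (4 * v)) * x ^ 2) := by
    have hms : MeasurableSet {x : ℝ | M < x ^ 2} := measurableSet_lt measurable_const (by fun_prop)
    refine integral_mono_of_nonneg (ae_of_all _ fun x => (Real.exp_pos _).le) hi.integrableOn ?_
    refine (ae_restrict_iff' hms).2 (ae_of_all _ fun x hx => ?_)
    replace hx : M < x ^ 2 := hx
    simp only
    rw [← Real.exp_add]
    apply Real.exp_le_exp.2
    have e : -M / (4 * v) + -(1 / (4 * v)) * x ^ 2 - -x ^ 2 / (2 * v) = (x ^ 2 - M) / (4 * v) := by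
      field_simp; ring
    have : 0 ≤ (x ^ 2 - M) / (4 * v) := div_nonneg (by linarith) (by positivity)
    linarith
  have h2 : ∫ x in {x : ℝ | M < x ^ 2}, Real.exp (-M / (4 * v)) * Real.exp (-(1 / (4 * v)) * x ^ 2) ≤
      Real.exp (-M / (4 * v)) * Real.sqrt (4 * Real.pi * v) := by
    refine (setIntegral_le_integral hi (ae_of_all _ fun x => by positivity)).trans ?_
    rw [integral_const_mul, integral_gaussian]
    apply le_of_eq; congr 2; field_simp
  have hc : (2 * Real.pi * v) ^ (-(1 : ℝ) / 2) * Real.sqrt (4 * Real.pi * v) ≤ 2 := by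
    have hp : 0 < 2 * Real.pi * v := by positivity
    have e1 : (2 * Real.pi * v) ^ (-(1 : ℝ) / 2) = (Real.sqrt (2 * Real.pi * v))⁻¹ := by
      rw [neg_div, Real.rpow_neg hp.le, Real.sqrt_eq_rpow]
    rw [e1, inv_mul_le_iff₀ (Real.sqrt_pos.2 hp)]
    rw [Real.sqrt_le_left (by positivity), mul_pow, Real.sq_sqrt hp.le]
    nlinarith
  have h0 : 0 ≤ (2 * Real.pi * v) ^ (-(1 : ℝ) / 2) := by positivity
  calc _ ≤ (2 * Real.pi * v) ^ (-(1 : ℝ) / 2) * (Real.exp (-M / (4 * v)) * Real.sqrt (4 * Real.pi * v)) :=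
        mul_le_mul_of_nonneg_left (h1.trans h2) h0
    _ = ((2 * Real.pi * v) ^ (-(1 : ℝ) / 2) * Real.sqrt (4 * Real.pi * v)) * Real.exp (-M / (4 * v)) := by ring
    _ ≤ _ := mul_le_mul_of_nonneg_right hc (Real.exp_pos _).le

lemma tail_prob {Ω : Type*} [m0 : MeasurableSpace Ω] (P : Measure Ω) [IsProbabilityMeasure P]
    (m : MeasurableSpace Ω) (hm : m ≤ m0) (Y V : Ω → ℝ) (hY : Measurable[m0] Y)
    (hV : Measurable[m] V) (hV1 : ∀ ω, 1 ≤ V ω)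
    (hG : ∀ A : Set ℝ, MeasurableSet A →
      (P[Set.indicator {ω | Y ω ∈ A} (fun _ => (1 : ℝ))|m]) =ᵐ[P]
        fun ω => (2 * Real.pi * V ω) ^ (-(1 : ℝ) / 2) * ∫ x in A, Real.exp (-x ^ 2 / (2 * V ω)))
    (S : ℝ) (hS : 0 ≤ S) :
    P {ω | 2 * V ω * S < (Y ω) ^ 2} ≤ ENNReal.ofReal (2 * Real.exp (-S / 4)) := by
  set E := {ω | 2 * V ω * S < (Y ω) ^ 2}
  let B : ℕ → Set Ω := fun k => {ω | ⌊V ω⌋₊ = k}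
  let A : ℕ → Set ℝ := fun k => {x | ((k:ℝ) + 1) * S < x ^ 2}
  have hBm : ∀ k, MeasurableSet[m] (B k) := fun k =>
    (Nat.measurable_floor.comp hV) (measurableSet_singleton k)
  have hAm : ∀ k, MeasurableSet (A k) := fun k => measurableSet_lt measurable_const (by fun_prop)
  have hYA : ∀ k, MeasurableSet[m0] {ω | Y ω ∈ A k} := fun k => hY (hAm k)
  have hBk : ∀ k, P (E ∩ B k) ≤ ENNReal.ofReal (2 * Real.exp (-S / 4)) * P (B k) := by
    intro k
    have hsub : E ∩ B k ⊆ {ω | Y ω ∈ A k} ∩ B k := by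
      rintro ω ⟨h1, h2⟩
      refine ⟨?_, h2⟩
      have hfl : (⌊V ω⌋₊ : ℝ) ≤ V ω := Nat.floor_le (by linarith [hV1 ω])
      have h2' : ⌊V ω⌋₊ = k := h2
      rw [h2'] at hfl
      have h1' : 2 * V ω * S < (Y ω) ^ 2 := h1
      show ((k:ℝ) + 1) * S < (Y ω) ^ 2
      have := hV1 ω
      nlinarith
    refine (measure_mono hsub).trans ?_
    have hreal : P.real ({ω | Y ω ∈ A k} ∩ B k) ≤ 2 * Real.exp (-S / 4) * P.real (B k) := by
      have hint : Integrable (Set.indicator {ω | Y ω ∈ A k} (fun _ => (1 : ℝ))) P :=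
        (integrable_const 1).indicator (hYA k)
      have e1 := setIntegral_condExp hm hint (hBm k)
      have e2 : ∫ ω in B k, Set.indicator {ω | Y ω ∈ A k} (fun _ => (1 : ℝ)) ω ∂P =
          P.real ({ω | Y ω ∈ A k} ∩ B k) := by
        rw [integral_indicator (hYA k), setIntegral_const, smul_eq_mul, mul_one,
          measureReal_restrict_apply (hYA k)]
      rw [← e2, ← e1]
      have e3 : ∫ ω in B k, 2 * Real.exp (-S / 4) ∂P = 2 * Real.exp (-S / 4) * P.real (B k) := by
        rw [setIntegral_const, smul_eq_mul, mul_comm]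
      rw [← e3]
      refine integral_mono_ae integrable_condExp.integrableOn (integrable_const _) ?_
      refine (ae_restrict_iff' (hm _ (hBm k))).2 ?_
      filter_upwards [hG (A k) (hAm k)] with ω hω hB
      rw [hω]
      have hv : 0 < V ω := by linarith [hV1 ω]
      refine (tail_gauss (V ω) _ hv).trans ?_
      have hB' : ⌊V ω⌋₊ = k := hB
      have hfl := Nat.lt_floor_add_one (V ω)
      rw [hB'] at hfl
      apply mul_le_mul_of_nonneg_left _ (by norm_num)
      apply Real.exp_le_exp.2
      rw [div_le_div_iff₀ (by positivity) (by norm_num)]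
      nlinarith
    have := ENNReal.ofReal_le_ofReal hreal
    rwa [ENNReal.ofReal_mul (by positivity), ofReal_measureReal, ofReal_measureReal] at this
  have hBdisj : Pairwise (Function.onFun Disjoint B) := by
    intro i j hij
    refine Set.disjoint_left.2 fun ω h1 h2 => hij ?_
    have h1' : ⌊V ω⌋₊ = i := h1
    have h2' : ⌊V ω⌋₊ = j := h2
    omega
  calc P E ≤ P (⋃ k, E ∩ B k) := measure_mono fun ω hω => Set.mem_iUnion.2 ⟨⌊V ω⌋₊, hω, rfl⟩
    _ ≤ ∑' k, P (E ∩ B k) := measure_iUnion_le _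
    _ ≤ ∑' k, ENNReal.ofReal (2 * Real.exp (-S / 4)) * P (B k) := ENNReal.tsum_le_tsum hBk
    _ = ENNReal.ofReal (2 * Real.exp (-S / 4)) * P (⋃ k, B k) := by
        rw [ENNReal.tsum_mul_left, measure_iUnion hBdisj fun k => hm _ (hBm k)]
    _ ≤ ENNReal.ofReal (2 * Real.exp (-S / 4)) * 1 := by gcongr; exact prob_le_one
    _ = _ := mul_one _

lemma super_step {Ω : Type*} [m0 : MeasurableSpace Ω] (P : Measure Ω) [IsProbabilityMeasure P]
    (m : MeasurableSpace Ω) (hm : m ≤ m0) (I W q : Ω → ℝ) (hI : Measurable[m0] I)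
    (hI01 : ∀ ω, I ω = 0 ∨ I ω = 1)
    (hW : Measurable[m] W) (hq : Measurable[m] q) (hW0 : ∀ ω, 0 ≤ W ω) (C κ : ℝ) (hWC : ∀ ω, W ω ≤ C)
    (hqκ : ∀ ω, q ω ≤ κ)
    (hc : q ≤ᵐ[P] P[I|m]) :
    ∫ ω, W ω * Real.exp (-I ω + q ω / 2) ∂P ≤ ∫ ω, W ω ∂P := by
  let G : Ω → ℝ := fun ω => W ω * Real.exp (q ω / 2)
  have hGm : Measurable[m] G := by
    have h : Measurable[m] (fun ω => q ω / 2) := hq.div_const 2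
    exact hW.mul (Real.measurable_exp.comp h)
  have hG0 : ∀ ω, 0 ≤ G ω := fun ω => mul_nonneg (hW0 ω) (Real.exp_pos _).le
  have hGC : ∀ ω, G ω ≤ C * Real.exp (κ / 2) := fun ω => by
    apply mul_le_mul (hWC ω) _ (Real.exp_pos _).le ((hW0 ω).trans (hWC ω))
    apply Real.exp_le_exp.2; linarith [hqκ ω]
  have hGi : Integrable G P := by
    refine Integrable.of_bound (hGm.mono hm le_rfl).aestronglyMeasurable (C * Real.exp (κ / 2)) ?_
    exact ae_of_all _ fun ω => by rw [Real.norm_of_nonneg (hG0 ω)]; exact hGC ω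
  have hWi : Integrable W P := by
    refine Integrable.of_bound (hW.mono hm le_rfl).aestronglyMeasurable C ?_
    exact ae_of_all _ fun ω => by rw [Real.norm_of_nonneg (hW0 ω)]; exact hWC ω
  have hIi : Integrable I P := by
    refine Integrable.of_bound hI.aestronglyMeasurable 1 (ae_of_all _ fun ω => ?_)
    rcases hI01 ω with h | h <;> simp [h]
  have hGI : Integrable (G * I) P := by
    refine Integrable.of_bound ((hGm.mono hm le_rfl).mul hI).aestronglyMeasurable
      (C * Real.exp (κ / 2)) (ae_of_all _ fun ω => ?_)
    simp only [Pi.mul_apply]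
    rcases hI01 ω with h | h
    · simp only [h, mul_zero, norm_zero]; exact (hG0 ω).trans (hGC ω)
    · simp only [h, mul_one]; rw [Real.norm_of_nonneg (hG0 ω)]; exact hGC ω
  have hpull := condExp_mul_of_stronglyMeasurable_left (μ := P) (m := m) hGm.stronglyMeasurable hGI hIi
  have hint : ∫ ω, (G * I) ω ∂P = ∫ ω, (G * P[I|m]) ω ∂P := by
    rw [← integral_condExp hm (f := G * I)]
    exact integral_congr_ae hpull
  have hGpi : Integrable (G * P[I|m]) P := (integrable_congr hpull).1 integrable_condExp
  calc ∫ ω, W ω * Real.exp (-I ω + q ω / 2) ∂P ≤ ∫ ω, (G ω - (1/2) * (G * I) ω) ∂P := by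
        refine integral_mono_of_nonneg (ae_of_all _ fun ω => mul_nonneg (hW0 ω) (Real.exp_pos _).le)
          (hGi.sub (hGI.const_mul _)) (ae_of_all _ fun ω => ?_)
        simp only [Pi.mul_apply]
        have e : W ω * Real.exp (-I ω + q ω / 2) = G ω * Real.exp (-I ω) := by
          simp only [G]; rw [Real.exp_add]; ring
        rw [e]
        rcases hI01 ω with h | h
        · simp [h]
        · rw [h]
          have h2 : Real.exp (-1) ≤ 1 / 2 := by
            rw [Real.exp_neg, one_div]
            apply inv_anti₀ (by norm_num)
            linarith [Real.add_one_le_exp (1:ℝ)]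
          nlinarith [mul_le_mul_of_nonneg_left h2 (hG0 ω)]
    _ = ∫ ω, (G ω - (1/2) * (G * P[I|m]) ω) ∂P := by
        rw [integral_sub hGi (hGI.const_mul _), integral_sub hGi (hGpi.const_mul _),
          integral_const_mul, integral_const_mul, hint]
    _ ≤ ∫ ω, W ω ∂P := by
        refine integral_mono_ae (hGi.sub (hGpi.const_mul _)) hWi ?_
        filter_upwards [hc] with ω hω
        simp only [Pi.mul_apply]
        have h1 : Real.exp (q ω / 2) * (1 - q ω / 2) ≤ 1 := by
          have := Real.add_one_le_exp (-(q ω / 2))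
          calc _ ≤ Real.exp (q ω / 2) * Real.exp (-(q ω / 2)) :=
                mul_le_mul_of_nonneg_left (by linarith) (Real.exp_pos _).le
            _ = 1 := by rw [← Real.exp_add]; simp
        have h2 := mul_le_mul_of_nonneg_left hω (hG0 ω)
        have h3 := mul_le_mul_of_nonneg_left h1 (hW0 ω)
        have h4 : G ω = W ω * Real.exp (q ω / 2) := rfl
        rw [h4] at h2 ⊢
        nlinarith

lemma exists_good_set (f : ℝ → ℝ) (hf : Measurable f) (hpos : 0 < volume {x : ℝ | 0 < |f x|}) :
    ∃ (A : Set ℝ) (e κ : ℝ), MeasurableSet A ∧ 0 < e ∧ 0 < κ ∧ (∀ x ∈ A, e ≤ (f x) ^ 2) ∧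
      ∀ v : ℝ, 1 ≤ v → κ / Real.sqrt v ≤
        (2 * Real.pi * v) ^ (-(1 : ℝ) / 2) * ∫ x in A, Real.exp (-x ^ 2 / (2 * v)) := by
  let A : ℕ → Set ℝ := fun n => {x | 1 / ((n:ℝ) + 1) ≤ |f x|} ∩ Set.Icc (-(n:ℝ)) n
  have hAm : ∀ n, MeasurableSet (A n) := fun n =>
    (measurableSet_le measurable_const (by fun_prop)).inter measurableSet_Icc
  obtain ⟨n, hn⟩ : ∃ n, 0 < volume (A n) := by
    by_contra hc
    push Not at hc
    have h0 : volume (⋃ n, A n) = 0 := measure_iUnion_null fun n => le_antisymm (hc n) (zero_le)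
    have hsub : {x : ℝ | 0 < |f x|} ⊆ ⋃ n, A n := by
      intro x hx
      have hx' : 0 < |f x| := hx
      obtain ⟨n1, h1⟩ := exists_nat_ge (1 / |f x|)
      obtain ⟨n2, h2⟩ := exists_nat_ge |x|
      refine Set.mem_iUnion.2 ⟨max n1 n2, ?_, ?_⟩
      · show 1 / (((max n1 n2 : ℕ):ℝ) + 1) ≤ |f x|
        rw [div_le_iff₀ (by positivity)]
        rw [div_le_iff₀ hx'] at h1
        have : (n1:ℝ) ≤ ((max n1 n2 : ℕ):ℝ) := by exact_mod_cast le_max_left _ _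
        nlinarith
      · have : (n2:ℝ) ≤ ((max n1 n2 : ℕ):ℝ) := by exact_mod_cast le_max_right _ _
        exact abs_le.1 (h2.trans this)
    exact absurd (measure_mono_null hsub h0) hpos.ne'
  have hfin : volume (A n) ≠ ⊤ := ne_of_lt (lt_of_le_of_lt (measure_mono Set.inter_subset_right)
    (by simp))
  have hvol : 0 < volume.real (A n) := ENNReal.toReal_pos hn.ne' hfin
  refine ⟨A n, (1 / ((n:ℝ) + 1)) ^ 2,
    (2 * Real.pi) ^ (-(1 : ℝ) / 2) * (Real.exp (-(n:ℝ) ^ 2 / 2) * volume.real (A n)), hAm n, by positivity,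
    by positivity, ?_, ?_⟩
  · rintro x ⟨hx, -⟩
    rw [← sq_abs (f x)]
    exact pow_le_pow_left₀ (by positivity) hx 2
  · intro v hv
    have hv0 : 0 < v := by linarith
    have e1 : (2 * Real.pi * v) ^ (-(1 : ℝ) / 2) = (2 * Real.pi) ^ (-(1 : ℝ) / 2) / Real.sqrt v := by
      rw [Real.mul_rpow (by positivity) hv0.le, neg_div, Real.rpow_neg hv0.le, ← Real.sqrt_eq_rpow, ← div_eq_mul_inv]
    rw [e1]
    have h1 : Real.exp (-(n:ℝ) ^ 2 / 2) * volume.real (A n) ≤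
        ∫ x in A n, Real.exp (-x ^ 2 / (2 * v)) := by
      have : ∫ x in A n, Real.exp (-(n:ℝ) ^ 2 / 2) = Real.exp (-(n:ℝ) ^ 2 / 2) * volume.real (A n) := by
        rw [setIntegral_const, smul_eq_mul, mul_comm]
      rw [← this]
      have hb : 0 < 1 / (2 * v) := by positivity
      have hi : Integrable (fun x : ℝ => Real.exp (-x ^ 2 / (2 * v))) := by
        have := integrable_exp_neg_mul_sq hb
        refine this.congr (ae_of_all _ fun x => ?_)
        simp only; congr 1; ring
      refine setIntegral_mono_on (integrableOn_const hfin) hi.integrableOn (hAm n) ?_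
      rintro x ⟨-, hx⟩
      apply Real.exp_le_exp.2
      have hx2 : x ^ 2 ≤ (n:ℝ) ^ 2 := sq_le_sq' hx.1 hx.2
      rw [div_le_div_iff₀ (by norm_num) (by positivity)]
      nlinarith [sq_nonneg x, sq_nonneg (n:ℝ)]
    have h2 : 0 ≤ (2 * Real.pi) ^ (-(1 : ℝ) / 2) / Real.sqrt v := by positivity
    calc _ = (2 * Real.pi) ^ (-(1 : ℝ) / 2) / Real.sqrt v * (Real.exp (-(n:ℝ) ^ 2 / 2) * volume.real (A n)) := by ring
      _ ≤ _ := mul_le_mul_of_nonneg_left h1 h2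

lemma summ2 : Summable fun t : ℕ => 1 / ((t:ℝ) + 1) ^ 2 := by
  have := (summable_nat_add_iff 1).2 (Real.summable_one_div_nat_pow.2 (by norm_num : 1 < 2))
  simpa using this

lemma exp_log2 (t : ℕ) : Real.exp (2 * Real.log ((t:ℝ) + 1)) = ((t:ℝ) + 1) ^ 2 := by
  rw [mul_comm, Real.exp_mul, Real.exp_log (by positivity)]
  norm_cast

theorem stmt_16
    {Ω : Type*} [MeasurableSpace Ω] (P : Measure Ω) [IsProbabilityMeasure P]
    (y : ℕ → Ω → ℝ) (hy : ∀ t, Measurable (y t))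
    (f : ℝ → ℝ) (hf : Measurable f)
    (P₀ : ℝ) (hP₀ : 0 < P₀)
    (R σ2 : ℕ → Ω → ℝ)
    (hR : ∀ t ω, R t ω = P₀⁻¹ + ∑ i ∈ Finset.range t, (f (y i ω)) ^ 2)
    (hσ2 : ∀ t ω, σ2 t ω = R (t + 1) ω / R t ω)
    (𝔉 : ℕ → MeasurableSpace Ω)
    (h𝔉 : ∀ t, 𝔉 t = ⨆ i : Fin (t + 1), MeasurableSpace.comap (y i) inferInstance)
    (hGauss : ∀ t : ℕ, ∀ A : Set ℝ, MeasurableSet A →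
      (P[Set.indicator {ω | y (t + 1) ω ∈ A} (fun _ => (1 : ℝ))|𝔉 t]) =ᵐ[P]
        fun ω => (2 * Real.pi * σ2 t ω) ^ (-(1 : ℝ) / 2) *
          ∫ x in A, Real.exp (-x ^ 2 / (2 * σ2 t ω)))
    (a γ₁ γ₂ : ℝ) (ha : 4 ≤ a) (hγ₁ : 0 < γ₁) (hγ₂ : 0 < γ₂)
    (hfgrow : ∀ x : ℝ, |f x| ≤ γ₁ + γ₂ * |x| ^ a)
    (hpos : 0 < volume {x : ℝ | 0 < |f x|}) :
    P (symmDiff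
      {ω | ¬ BddAbove (Set.range fun t => Real.sqrt (σ2 t ω))}
      {ω | ((1 + (a - 2 - Real.sqrt ((a - 2) ^ 2 - 4)) / 2 : ℝ) : EReal) ≤
        Filter.liminf (fun t : ℕ =>
          ((Real.log (R (t + 1) ω) / Real.log (R t ω) : ℝ) : EReal)) Filter.atTop}) = 0 := by
  -- basic facts
  have hRpos : ∀ ω t, 0 < R t ω := fun ω t => by
    rw [hR]; exact add_pos_of_pos_of_nonneg (inv_pos.2 hP₀) (Finset.sum_nonneg fun i _ => sq_nonneg _)
  have hrec : ∀ ω t, R (t+1) ω = R t ω + (f (y t ω)) ^ 2 := fun ω t => by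
    rw [hR, hR, Finset.sum_range_succ]; ring
  have hmono : ∀ ω t, R t ω ≤ R (t+1) ω := fun ω t => by
    rw [hrec]; linarith [sq_nonneg (f (y t ω))]
  have hσ1 : ∀ t ω, 1 ≤ σ2 t ω := fun t ω => by
    rw [hσ2, one_le_div (hRpos ω t)]; exact hmono ω t
  have h𝔉le : ∀ t, 𝔉 t ≤ ‹MeasurableSpace Ω› := fun t => by
    rw [h𝔉]; exact iSup_le fun i => (hy i).comap_le
  have hyad : ∀ t i, i ≤ t → Measurable[𝔉 t] (y i) := fun t i hi => by
    rw [h𝔉 t]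
    have h1 : MeasurableSpace.comap (y i) inferInstance ≤
        ⨆ i : Fin (t + 1), MeasurableSpace.comap (y i) inferInstance :=
      le_iSup (fun i : Fin (t + 1) => MeasurableSpace.comap (y i) inferInstance) ⟨i, by omega⟩
    exact (comap_measurable (y i)).mono h1 le_rfl
  have hRad : ∀ t i, i ≤ t + 1 → Measurable[𝔉 t] (R i) := fun t i hi => by
    have : R i = fun ω => P₀⁻¹ + ∑ j ∈ Finset.range i, (f (y j ω)) ^ 2 := funext fun ω => hR i ω
    rw [this]
    refine Measurable.const_add ?_ _
    refine Finset.measurable_fun_sum _ fun j hj => ?_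
    exact (hf.comp (hyad t j (by have := Finset.mem_range.1 hj; omega))).pow_const 2
  have hσad : ∀ t i, i ≤ t → Measurable[𝔉 t] (σ2 i) := fun t i hi => by
    have : σ2 i = fun ω => R (i+1) ω / R i ω := funext fun ω => hσ2 i ω
    rw [this]
    exact (hRad t (i+1) (by omega)).div (hRad t i (by omega))
  -- tails
  have htail : ∀ᵐ ω ∂P, ∀ᶠ t : ℕ in atTop,
      (y (t+1) ω) ^ 2 ≤ 16 * (R (t+1) ω / R t ω) * Real.log ((t:ℝ)+1) := by
    have hb : ∀ t : ℕ, P {ω | 2 * σ2 t ω * (8 * Real.log ((t:ℝ)+1)) < (y (t+1) ω) ^ 2} ≤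
        ENNReal.ofReal (2 * (1 / ((t:ℝ) + 1) ^ 2)) := fun t => by
      refine (tail_prob P (𝔉 t) (h𝔉le t) (y (t+1)) (σ2 t) (hy _) (hσad t t le_rfl) (hσ1 t)
        (hGauss t) (8 * Real.log ((t:ℝ)+1)) ?_).trans (le_of_eq ?_)
      · have := Real.log_nonneg (by linarith [(Nat.cast_nonneg t : (0:ℝ) ≤ t)] : (1:ℝ) ≤ (t:ℝ) + 1)
        positivity
      · congr 2
        rw [← exp_log2, one_div, ← Real.exp_neg]; congr 1; ring
    have hne : ∑' t : ℕ, P {ω | 2 * σ2 t ω * (8 * Real.log ((t:ℝ)+1)) < (y (t+1) ω) ^ 2} ≠ ⊤ :=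
      ne_top_of_le_ne_top (summ2.mul_left 2).tsum_ofReal_ne_top (ENNReal.tsum_le_tsum hb)
    filter_upwards [ae_eventually_notMem hne] with ω hω
    filter_upwards [hω] with t ht
    have ht' : ¬ (2 * σ2 t ω * (8 * Real.log ((t:ℝ)+1)) < (y (t+1) ω) ^ 2) := ht
    rw [← hσ2]
    linarith
  -- growth
  obtain ⟨A, e, κ, hA, he, hκ, hAe, hAκ⟩ := exists_good_set f hf hpos
  let I : ℕ → Ω → ℝ := fun t => Set.indicator {ω | y (t + 1) ω ∈ A} (fun _ => (1 : ℝ))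
  let q : ℕ → Ω → ℝ := fun t ω => κ / Real.sqrt (σ2 t ω)
  let N : ℕ → Ω → ℝ := fun t ω => ∑ i ∈ Finset.range t, I i ω
  let S : ℕ → Ω → ℝ := fun t ω => ∑ i ∈ Finset.range t, q i ω
  let W : ℕ → Ω → ℝ := fun t ω => Real.exp (-N t ω + S t ω / 2)
  have hI01 : ∀ t ω, I t ω = 0 ∨ I t ω = 1 := fun t ω => by
    by_cases h : ω ∈ {ω | y (t + 1) ω ∈ A}
    · right; exact Set.indicator_of_mem h _
    · left; exact Set.indicator_of_notMem h _
  have hIad : ∀ t i, i + 1 ≤ t → Measurable[𝔉 t] (I i) := fun t i hi =>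
    (measurable_const).indicator (hyad t (i+1) hi hA)
  have hIm : ∀ t, Measurable (I t) := fun t => (hIad (t+1) t le_rfl).mono (h𝔉le _) le_rfl
  have hqad : ∀ t i, i ≤ t → Measurable[𝔉 t] (q i) := fun t i hi =>
    Measurable.const_div (Real.continuous_sqrt.measurable.comp (hσad t i hi)) κ
  have hWad : ∀ t, Measurable[𝔉 t] (W t) := fun t => by
    refine Real.measurable_exp.comp ?_
    refine Measurable.add (Measurable.neg ?_) (Measurable.div_const ?_ 2)
    · refine Finset.measurable_fun_sum _ fun j hj => hIad t j (Finset.mem_range.1 hj)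
    · refine Finset.measurable_fun_sum _ fun j hj => hqad t j (Finset.mem_range.1 hj).le
  have hqκ : ∀ t ω, q t ω ≤ κ := fun t ω => by
    refine div_le_self hκ.le ?_
    rw [Real.one_le_sqrt]; exact hσ1 t ω
  have hN0 : ∀ t ω, 0 ≤ N t ω := fun t ω => Finset.sum_nonneg fun i _ => by
    rcases hI01 i ω with h | h <;> simp [h]
  have hWC : ∀ t ω, W t ω ≤ Real.exp (t * κ) := fun t ω => by
    apply Real.exp_le_exp.2
    have h1 : S t ω ≤ t * κ := by
      have := Finset.sum_le_card_nsmul (Finset.range t) (fun i => q i ω) κ fun i _ => hqκ i ω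
      simpa using this
    have h2 : 0 ≤ (t:ℝ) * κ := by positivity
    linarith [hN0 t ω]
  have hWint : ∀ t, ∫ ω, W t ω ∂P ≤ 1 := fun t => by
    induction t with
    | zero => simp [W, N, S]
    | succ t ih =>
      refine le_trans (le_of_eq ?_) ((super_step P (𝔉 t) (h𝔉le t) (I t) (W t) (q t) (hIm t) (hI01 t)
        (hWad t) (hqad t t le_rfl) (fun ω => (Real.exp_pos _).le) _ κ (hWC t) (hqκ t) ?_).trans ih)
      · congr 1; funext ω
        simp only [W, N, S, Finset.sum_range_succ]
        rw [← Real.exp_add]; congr 1; ring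
      · filter_upwards [hGauss t A hA] with ω hω
        simp only [I, q]
        rw [hω]
        exact hAκ _ (hσ1 t ω)
  have hWev : ∀ᵐ ω ∂P, ∀ᶠ t : ℕ in atTop, S t ω / 2 - 2 * Real.log ((t:ℝ)+1) ≤ N t ω := by
    have hb : ∀ t : ℕ, P {ω | ((t:ℝ) + 1) ^ 2 ≤ W t ω} ≤ ENNReal.ofReal (1 / ((t:ℝ) + 1) ^ 2) := fun t => by
      have hWm := (hWad t).mono (h𝔉le t) le_rfl
      have hi : Integrable (W t) P := by
        refine Integrable.of_bound hWm.aestronglyMeasurable (Real.exp (t * κ)) (ae_of_all _ fun ω => ?_)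
        rw [Real.norm_of_nonneg (Real.exp_pos _).le]; exact hWC t ω
      have h1 := (mul_meas_ge_le_integral_of_nonneg (ae_of_all _ fun ω => (Real.exp_pos _).le) hi
        (((t:ℝ) + 1) ^ 2)).trans (hWint t)
      rw [← ofReal_measureReal]
      apply ENNReal.ofReal_le_ofReal
      rw [le_div_iff₀ (by positivity)]
      linarith
    have hne : ∑' t : ℕ, P {ω | ((t:ℝ) + 1) ^ 2 ≤ W t ω} ≠ ⊤ :=
      ne_top_of_le_ne_top summ2.tsum_ofReal_ne_top (ENNReal.tsum_le_tsum hb)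
    filter_upwards [ae_eventually_notMem hne] with ω hω
    filter_upwards [hω] with t ht
    have ht' : ¬ (((t:ℝ) + 1) ^ 2 ≤ W t ω) := ht
    rw [not_le, ← exp_log2] at ht'
    have := Real.exp_lt_exp.1 ht'
    linarith
  -- root facts
  have hsq : 0 ≤ (a - 2) ^ 2 - 4 := by nlinarith
  set s := Real.sqrt ((a - 2) ^ 2 - 4) with hs
  have hs2 : s ^ 2 = (a - 2) ^ 2 - 4 := Real.sq_sqrt hsq
  have hs0 : 0 ≤ s := Real.sqrt_nonneg _
  have hx0 : 0 < (a - 2 - s) / 2 := by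
    have : s < a - 2 := by
      by_contra hc
      push Not at hc
      nlinarith
    linarith
  have hxeq : ((a - 2 - s) / 2) ^ 2 - (a - 2) * ((a - 2 - s) / 2) + 1 = 0 := by
    nlinarith
  have hmain : {ω | ¬ BddAbove (Set.range fun t => Real.sqrt (σ2 t ω))} =ᵐ[P]
      {ω | ((1 + (a - 2 - s) / 2 : ℝ) : EReal) ≤
        Filter.liminf (fun t : ℕ =>
          ((Real.log (R (t + 1) ω) / Real.log (R t ω) : ℝ) : EReal)) Filter.atTop} := by
    rw [Filter.eventuallyEq_set]
    filter_upwards [htail, hWev] with ω h1 h2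
    constructor
    · intro hD1
      by_contra hD2
      have hD2' : ¬ (((1 + (a - 2 - s) / 2 : ℝ) : EReal) ≤ Filter.liminf (fun t : ℕ =>
          ((Real.log (R (t + 1) ω) / Real.log (R t ω) : ℝ) : EReal)) Filter.atTop) := hD2
      rw [not_le, EReal.lt_iff_exists_real_btwn] at hD2'
      obtain ⟨b, hb1, hb2⟩ := hD2'
      have hb3 : b < 1 + (a - 2 - s) / 2 := by exact_mod_cast hb2
      have hfreq := frequently_lt_of_liminf_lt (by isBoundedDefault) hb1
      have hgr := growth_det (fun t => R t ω) (fun t => N t ω) (fun t => S t ω) (hRpos ω) (hmono ω)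
        e κ he hκ (fun t => by simp only [S, q, hσ2]) (fun t => by
          show e * N t ω ≤ R (t+1) ω
          simp only [N]
          rw [hR, Finset.sum_range_succ', Finset.mul_sum]
          have : ∑ i ∈ Finset.range t, e * I i ω ≤ ∑ i ∈ Finset.range t, (f (y (i+1) ω)) ^ 2 := by
            refine Finset.sum_le_sum fun i _ => ?_
            by_cases h : ω ∈ {ω | y (i + 1) ω ∈ A}
            · simp only [I]; rw [Set.indicator_of_mem h, mul_one]; exact hAe _ h
            · simp only [I]; rw [Set.indicator_of_notMem h, mul_zero]; positivity
          have h3 := inv_pos.2 hP₀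
          have h4 := sq_nonneg (f (y 0 ω))
          linarith) h2
      have hlim : Tendsto (fun t => R t ω) atTop atTop := by
        rw [← tendsto_add_atTop_iff_nat 1]
        refine tendsto_atTop_mono' _ hgr ?_
        exact Real.tendsto_sqrt_atTop.comp
          (tendsto_atTop_add_const_right _ _ tendsto_natCast_atTop_atTop)
      have hstep := step_of_bounds f (fun t => y t ω) (fun t => R t ω) (hRpos ω) (hmono ω) hlim
        (hrec ω) a γ₁ γ₂ ha hγ₁ hγ₂ hfgrow h1 hgr
      obtain ⟨C, hC⟩ := det1 (fun t => R t ω) (hRpos ω) (hmono ω) hlim a ha hstep (b - 1)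
        ((a - 2 - s) / 2) hxeq hx0 (by linarith) (by linarith)
        (hfreq.mono fun t ht => by
          have : Real.log (R (t+1) ω) / Real.log (R t ω) < b := by exact_mod_cast ht
          linarith)
      apply hD1
      apply Filter.IsBoundedUnder.bddAbove_range
      refine ⟨Real.sqrt C, ?_⟩
      rw [eventually_map]
      filter_upwards [hC] with t ht
      rw [hσ2]
      exact Real.sqrt_le_sqrt ht
    · intro hD2
      have := det2 (fun t => R t ω) (hRpos ω) (hmono ω) _ hx0 hD2
      show ¬ BddAbove (Set.range fun t => Real.sqrt (σ2 t ω))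
      simpa only [hσ2] using this
  exact measure_symmDiff_eq_zero_iff.2 hmain
end

section
/- In the closed-loop least-squares setup, suppose a ≥ 4, |f(x)| ≤ γ₁ + γ₂·|x|^a for all x ∈ ℝ and some γ₁, γ₂ > 0, and the set {x ∈ ℝ : |f(x)| > 0} has positive Lebesgue measure. Let x_max = ((a−2) + √((a−2)² − 4))/2 be the largest real solution of x² − (a−2)x + 1 = 0. Then P(limsup_{t→+∞} (log r_t)/(log r_{t−1}) > 1 + x_max) = 0. -/
open MeasureTheory ProbabilityTheory Filter

lemma aux_density (A : Set ℝ) (s : ℝ) (hs : 0 < s) :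
    (2 * Real.pi * s) ^ (-(1 : ℝ) / 2) * ∫ x in A, Real.exp (-x ^ 2 / (2 * s))
      = (gaussianReal 0 s.toNNReal).real A := by
  have hv : s.toNNReal ≠ 0 := by simpa using hs
  rw [Measure.real, gaussianReal_apply_eq_integral _ hv, ENNReal.toReal_ofReal
    (integral_nonneg fun x => gaussianPDFReal_nonneg _ _ _), ← integral_const_mul]
  congr 1
  ext x
  rw [gaussianPDFReal, Real.coe_toNNReal _ hs.le, sub_zero, neg_div, Real.rpow_neg (by positivity),
    Real.sqrt_eq_rpow]

lemma aux_kernel {Ω : Type*} {m mΩ : MeasurableSpace Ω} (P : Measure Ω) [IsProbabilityMeasure P]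
    (hm : m ≤ mΩ) (X : Ω → ℝ × ℝ) (hX : Measurable[m] X)
    (hpos : ∀ ω, 0 < (X ω).2 / (X ω).1) (Y : Ω → ℝ) (hY : Measurable Y)
    (hG : ∀ A : Set ℝ, MeasurableSet A →
      (P[Set.indicator {ω | Y ω ∈ A} (fun _ => (1 : ℝ))|m]) =ᵐ[P]
        fun ω => (2 * Real.pi * ((X ω).2 / (X ω).1)) ^ (-(1 : ℝ) / 2) *
          ∫ x in A, Real.exp (-x ^ 2 / (2 * ((X ω).2 / (X ω).1))))
    (g : (ℝ × ℝ) × ℝ → ENNReal) (hg : Measurable g) :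
    ∫⁻ ω, g (X ω, Y ω) ∂P
      = ∫⁻ ω, ∫⁻ z, g (X ω, z) ∂(gaussianReal 0 ((X ω).2 / (X ω).1).toNNReal) ∂P := by
  have hX' : Measurable X := hX.mono hm le_rfl
  let κ : Kernel (ℝ × ℝ) ℝ :=
    ⟨fun p => gaussianReal 0 (p.2 / p.1).toNNReal, by
      exact measurable_gaussianReal.comp (f := fun p : ℝ × ℝ => ((0 : ℝ), (p.2 / p.1).toNNReal))
        (by fun_prop)⟩
  have hκ : ∀ p, κ p = gaussianReal 0 (p.2 / p.1).toNNReal := fun _ => rfl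
  have : IsMarkovKernel κ := ⟨fun p => by rw [hκ]; infer_instance⟩
  have : IsProbabilityMeasure (P.map X) := Measure.isProbabilityMeasure_map hX'.aemeasurable
  have key : P.map (fun ω => (X ω, Y ω)) = (P.map X) ⊗ₘ κ := by
    have : IsProbabilityMeasure (P.map (fun ω => (X ω, Y ω))) :=
      Measure.isProbabilityMeasure_map (hX'.prodMk hY).aemeasurable
    refine Measure.ext_prod ?_
    intro s t hs ht
    have hms : MeasurableSet[m] (X ⁻¹' s) := hX hs
    have hind : Integrable (Set.indicator {ω | Y ω ∈ t} (fun _ => (1 : ℝ))) P :=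
      (integrable_const _).indicator (hY ht)
    rw [Measure.map_apply (hX'.prodMk hY) (hs.prod ht), Measure.compProd_apply_prod hs ht,
      setLIntegral_map hs (κ.measurable_coe ht) hX']
    have h1 := setIntegral_condExp hm hind hms
    have h2 : ∫ ω in X ⁻¹' s, (P[Set.indicator {ω | Y ω ∈ t} (fun _ => (1 : ℝ))|m]) ω ∂P
        = ∫ ω in X ⁻¹' s, (κ (X ω)).real t ∂P := by
      refine integral_congr_ae (ae_restrict_of_ae ?_)
      filter_upwards [hG t ht] with ω hω
      rw [hω, aux_density _ _ (hpos ω), hκ]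
    rw [h2] at h1
    have h3 : ∫ ω in X ⁻¹' s, (Set.indicator {ω | Y ω ∈ t} (fun _ => (1 : ℝ))) ω ∂P
        = P.real (X ⁻¹' s ∩ Y ⁻¹' t) := by
      have : {ω | Y ω ∈ t} = Y ⁻¹' t := rfl
      rw [this, integral_indicator (hY ht)]
      simp [Measure.real, hY ht, Set.inter_comm]
    rw [h3] at h1
    have h4 : ENNReal.ofReal (∫ ω in X ⁻¹' s, (κ (X ω)).real t ∂P)
        = ∫⁻ ω in X ⁻¹' s, κ (X ω) t ∂P := by
      rw [ofReal_integral_eq_lintegral_ofReal]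
      · simp [Measure.real]
      · refine Integrable.of_bound (C := 1) ?_ ?_
        · exact ((κ.measurable_coe ht).comp hX').ennreal_toReal.aestronglyMeasurable
        · refine ae_of_all _ fun ω => ?_
          rw [Real.norm_of_nonneg measureReal_nonneg]
          exact measureReal_le_one
      · exact ae_of_all _ fun ω => measureReal_nonneg
    rw [← h4, h1]
    simp only [Measure.real, ne_eq, measure_ne_top, not_false_eq_true, ENNReal.ofReal_toReal]
    rfl
  rw [← lintegral_map (f := g) hg (hX'.prodMk hY), key, Measure.lintegral_compProd hg,
    lintegral_map (by exact hg.lintegral_kernel_prod_right' ) hX']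
  rfl

lemma aux_tail (v : NNReal) (hv : 0 < v) (K : ℝ) (hK : 0 ≤ K) :
    gaussianReal 0 v {z | K * v < z ^ 2} ≤ ENNReal.ofReal (2 * Real.exp (-K / 2)) := by
  have hv' : (0 : ℝ) < v := hv
  set e := Real.sqrt (K * v) with he
  have hee : e ^ 2 = K * v := Real.sq_sqrt (by positivity)
  have he0 : 0 ≤ e := Real.sqrt_nonneg _
  have h1 : (gaussianReal 0 v).real {z | e ≤ z} ≤ Real.exp (-K / 2) := by
    have := measure_ge_le_exp_mul_mgf (μ := gaussianReal 0 v) (X := fun x => x) (t := e / v) e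
      (by positivity) (integrable_exp_mul_gaussianReal _)
    rw [mgf_fun_id_gaussianReal, ← Real.exp_add] at this
    refine this.trans (Real.exp_le_exp.2 (le_of_eq ?_))
    field_simp
    linarith [hee]
  have h2 : (gaussianReal 0 v).real {z | z ≤ -e} ≤ Real.exp (-K / 2) := by
    have := measure_le_le_exp_mul_mgf (μ := gaussianReal 0 v) (X := fun x => x) (t := -(e / v)) (-e)
      (by simp; positivity) (integrable_exp_mul_gaussianReal _)
    rw [mgf_fun_id_gaussianReal, ← Real.exp_add] at this
    refine this.trans (Real.exp_le_exp.2 (le_of_eq ?_))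
    field_simp
    linarith [hee]
  have hsub : {z : ℝ | K * v < z ^ 2} ⊆ {z | e ≤ z} ∪ {z | z ≤ -e} := by
    intro z hz
    simp only [Set.mem_ofPred_eq, Set.mem_union] at *
    by_contra! hcon
    nlinarith
  rw [ENNReal.le_ofReal_iff_toReal_le (measure_ne_top _ _) (by positivity)]
  calc (gaussianReal 0 v).real {z | K * v < z ^ 2} ≤ (gaussianReal 0 v).real ({z | e ≤ z} ∪ {z | z ≤ -e}) :=
        measureReal_mono hsub
    _ ≤ _ := measureReal_union_le _ _
    _ ≤ _ := by linarith

/-- uniform lower bound for variances in `[1,2]` -/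
lemma aux_lower (B : Set ℝ) (hB : 0 < volume B) :
    ∃ p : ℝ, 0 < p ∧ ∀ v : NNReal, 1 ≤ v → v ≤ 2 → p ≤ (gaussianReal 0 v).real B := by
  refine ⟨(Real.sqrt 2)⁻¹ * (gaussianReal 0 1).real B, ?_, ?_⟩
  · have : gaussianReal 0 1 B ≠ 0 := fun h =>
      hB.ne' (gaussianReal_absolutelyContinuous' 0 (v := 1) one_ne_zero h)
    have : 0 < (gaussianReal 0 1).real B := ENNReal.toReal_pos this (measure_ne_top _ _)
    positivity
  · intro v h1 h2
    have hv0 : v ≠ 0 := by positivity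
    have h1' : (1 : ℝ) ≤ v := h1
    have h2' : (v : ℝ) ≤ 2 := h2
    rw [Measure.real, Measure.real, gaussianReal_apply_eq_integral _ one_ne_zero,
      gaussianReal_apply_eq_integral _ hv0, ENNReal.toReal_ofReal
      (integral_nonneg fun x => gaussianPDFReal_nonneg _ _ _), ENNReal.toReal_ofReal
      (integral_nonneg fun x => gaussianPDFReal_nonneg _ _ _), ← integral_const_mul]
    refine integral_mono ((integrable_gaussianPDFReal _ _).restrict.const_mul _)
      (integrable_gaussianPDFReal _ _).restrict fun x => ?_
    simp only [gaussianPDFReal, sub_zero, NNReal.coe_one, mul_one]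
    rw [← mul_assoc, ← mul_inv, ← Real.sqrt_mul (by norm_num)]
    have hpi := Real.pi_pos
    refine mul_le_mul ?_ ?_ (Real.exp_pos _).le (by positivity)
    · refine inv_anti₀ (by positivity) (Real.sqrt_le_sqrt ?_)
      nlinarith
    · refine Real.exp_le_exp.2 ?_
      rw [neg_div, neg_div, neg_le_neg_iff]
      refine div_le_div_of_nonneg_left (sq_nonneg x) (by norm_num) (by linarith)

lemma aux_limsup (q δ : ℕ → ℝ) (a : ℝ) (ha : 4 ≤ a) (hq1 : ∀ᶠ t in atTop, 1 ≤ q t)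
    (hδ : Tendsto δ atTop (nhds 0))
    (hq : ∀ᶠ t in atTop, q (t + 1) ≤ max 1 (a * (1 - 1 / q t)) + δ t) :
    limsup (fun t => (q t : EReal)) atTop
      ≤ ((1 + (a - 2 + Real.sqrt ((a - 2) ^ 2 - 4)) / 2 : ℝ) : EReal) := by
  set S := Real.sqrt ((a - 2) ^ 2 - 4) with hS
  have hS2 : S ^ 2 = (a - 2) ^ 2 - 4 := Real.sq_sqrt (by nlinarith)
  have hS0 : 0 ≤ S := Real.sqrt_nonneg _
  -- transfer of bounds
  have step : ∀ B η : ℝ, 1 ≤ B → 0 < η → (∀ᶠ t in atTop, q t ≤ B) →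
      ∀ᶠ t in atTop, q t ≤ max 1 (a * (1 - 1 / B)) + η := by
    intro B η hB hη hqB
    have : ∀ᶠ t in atTop, q (t + 1) ≤ max 1 (a * (1 - 1 / B)) + η := by
      filter_upwards [hqB, hq1, hq, hδ.eventually (gt_mem_nhds hη)] with t h1 h2 h3 h4
      have : a * (1 - 1 / q t) ≤ a * (1 - 1 / B) := by
        have := one_div_le_one_div_of_le (by linarith) h1
        nlinarith
      have := max_le_max (le_refl 1) this
      linarith
    exact (tendsto_add_atTop_iff_nat (f := q) 1 (l := Filter.principal {x | x ≤ max 1 (a * (1 - 1 / B)) + η})).1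
      (by simpa [tendsto_principal] using this) |> fun h => by simpa [tendsto_principal] using h
  have hbd : ∀ᶠ t in atTop, q t ≤ a + 1 := by
    have : ∀ᶠ t in atTop, q (t + 1) ≤ a + 1 := by
      filter_upwards [hq1, hq, hδ.eventually (gt_mem_nhds one_pos)] with t h2 h3 h4
      have h5 : 0 ≤ 1 / q t := by positivity
      have : max 1 (a * (1 - 1 / q t)) ≤ a := max_le (by linarith) (by nlinarith)
      linarith
    exact (tendsto_add_atTop_iff_nat (f := q) 1 (l := Filter.principal {x | x ≤ a + 1})).1
      (by simpa [tendsto_principal] using this) |> fun h => by simpa [tendsto_principal] using h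
  by_contra! hcon
  have hle : limsup (fun t => (q t : EReal)) atTop ≤ ((a + 1 : ℝ) : EReal) :=
    limsup_le_of_le (h := hbd.mono fun t ht => EReal.coe_le_coe_iff.2 ht)
  generalize hQ : limsup (fun t => (q t : EReal)) atTop = Q at hcon hle
  lift Q to ℝ using ⟨(lt_of_le_of_lt hle (EReal.coe_lt_top _)).ne,
    (lt_of_le_of_lt bot_le hcon).ne'⟩
  rw [EReal.coe_lt_coe_iff] at hcon
  have hQ2 : 2 < Q := by linarith
  have hlt : max 1 (a * (1 - 1 / Q)) < Q := by
    refine max_lt (by linarith) ?_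
    have : 0 < Q ^ 2 - a * Q + a := by nlinarith
    rw [← sub_pos]
    have h : Q - a * (1 - 1 / Q) = (Q ^ 2 - a * Q + a) / Q := by field_simp; ring
    rw [h]; positivity
  have hcont : ContinuousAt (fun B : ℝ => max 1 (a * (1 - 1 / B))) Q := by
    have : Q ≠ 0 := by linarith
    fun_prop (disch := assumption)
  have hev : ∀ᶠ B in nhdsWithin Q (Set.Ioi Q), max 1 (a * (1 - 1 / B)) < Q :=
    (hcont.eventually (gt_mem_nhds hlt)).filter_mono nhdsWithin_le_nhds
  obtain ⟨B, hB1, hB2⟩ := (hev.and self_mem_nhdsWithin).exists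
  have hB2' : Q < B := hB2
  have hqB : ∀ᶠ t in atTop, q t ≤ B := by
    have : limsup (fun t => (q t : EReal)) atTop < (B : EReal) := by
      rw [hQ]; exact_mod_cast hB2'
    filter_upwards [eventually_lt_of_limsup_lt this] with t ht
    exact le_of_lt (by exact_mod_cast ht)
  have := step B ((Q - max 1 (a * (1 - 1 / B))) / 2) (by linarith) (by linarith) hqB
  have h2 : limsup (fun t => (q t : EReal)) atTop
      ≤ ((max 1 (a * (1 - 1 / B)) + (Q - max 1 (a * (1 - 1 / B))) / 2 : ℝ) : EReal) :=
    limsup_le_of_le (h := this.mono fun t ht => EReal.coe_le_coe_iff.2 ht)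
  rw [hQ, EReal.coe_le_coe_iff] at h2
  linarith

lemma aux_det (r : ℕ → ℝ) (y2 : ℕ → ℝ) (a γ₁ γ₂ c : ℝ) (ha : 4 ≤ a) (hγ₁ : 0 < γ₁) (hγ₂ : 0 < γ₂)
    (hc : 0 < c) (hr : ∀ t, 0 < r t) (hmono : ∀ t, r t ≤ r (t + 1))
    (hgrow : ∀ᶠ t : ℕ in atTop, c * t ≤ r t)
    (hstep : ∀ t, r (t + 2) ≤ r (t + 1) + (γ₁ + γ₂ * |y2 t| ^ a) ^ 2)
    (hy : ∀ᶠ t : ℕ in atTop, (y2 t) ^ 2 ≤ 4 * Real.log (t + 1) * (r (t + 1) / r t)) :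
    limsup (fun t => ((Real.log (r (t + 1)) / Real.log (r t) : ℝ) : EReal)) atTop
      ≤ ((1 + (a - 2 + Real.sqrt ((a - 2) ^ 2 - 4)) / 2 : ℝ) : EReal) := by
  set C := (γ₁ + γ₂) ^ 2 with hC
  have hC0 : 0 < C := by positivity
  have hlog1 : Tendsto (fun t : ℕ => Real.log ((t : ℝ) + 1)) atTop atTop :=
    Real.tendsto_log_atTop.comp (tendsto_atTop_add_const_right _ 1 tendsto_natCast_atTop_atTop)
  have hr_top : Tendsto r atTop atTop :=
    tendsto_atTop_mono' _ hgrow (tendsto_natCast_atTop_atTop.const_mul_atTop hc)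
  have hL_top : Tendsto (fun t => Real.log (r t)) atTop atTop := Real.tendsto_log_atTop.comp hr_top
  have hL_top1 : Tendsto (fun t => Real.log (r (t + 1))) atTop atTop :=
    hL_top.comp (tendsto_add_atTop_nat 1)
  set N : ℕ → ℝ := fun t => |Real.log C| + a * Real.log (4 * Real.log (t + 1)) + Real.log 2 with hN
  refine aux_limsup (fun t => Real.log (r (t + 1)) / Real.log (r t))
    (fun t => N t / Real.log (r (t + 1))) a ha ?_ ?_ ?_
  · filter_upwards [hL_top.eventually_gt_atTop 0] with t ht
    rw [one_le_div ht]
    exact Real.log_le_log (hr t) (hmono t)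
  · -- N t / log r -> 0
    have hlo : ∀ᶠ t : ℕ in atTop, Real.log (t + 1) / 2 ≤ Real.log (r (t + 1)) := by
      filter_upwards [(tendsto_add_atTop_nat 1).eventually hgrow,
        hlog1.eventually_ge_atTop (-2 * Real.log c)] with t h1 h2
      have : Real.log (c * ((t : ℝ) + 1)) ≤ Real.log (r (t + 1)) :=
        Real.log_le_log (by positivity) (by simpa using h1)
      rw [Real.log_mul hc.ne' (by positivity)] at this
      linarith
    have hlim : Tendsto (fun t : ℕ => 2 * (N t / Real.log (t + 1))) atTop (nhds 0) := by
      have h0 : Tendsto (fun u : ℝ => 2 * ((|Real.log C| + Real.log 2 + a * Real.log 4) / u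
          + a * (Real.log u / u))) atTop (nhds (2 * (0 + a * 0))) := by
        refine Tendsto.const_mul _ (Tendsto.add ?_ (Tendsto.const_mul _ ?_))
        · exact tendsto_const_nhds.div_atTop tendsto_id
        · exact Real.isLittleO_log_id_atTop.tendsto_div_nhds_zero
      simp only [mul_zero, add_zero] at h0
      refine (h0.comp hlog1).congr' ?_
      filter_upwards [hlog1.eventually_gt_atTop 0] with t ht
      simp only [Function.comp, hN]
      rw [Real.log_mul (by norm_num) ht.ne']
      field_simp
      ring
    refine squeeze_zero' ?_ ?_ hlim
    · filter_upwards [hL_top1.eventually_gt_atTop 0, hlog1.eventually_ge_atTop 1] with t h1 h2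
      have : 0 ≤ Real.log (4 * Real.log (t + 1)) := Real.log_nonneg (by linarith)
      have := Real.log_nonneg (show (1 : ℝ) ≤ 2 by norm_num)
      simp only [hN]
      positivity
    · filter_upwards [hlo, hlog1.eventually_ge_atTop 1] with t h1 h2
      have h3 : 0 ≤ Real.log (4 * Real.log (t + 1)) := Real.log_nonneg (by linarith)
      have h4 := Real.log_nonneg (show (1 : ℝ) ≤ 2 by norm_num)
      have h5 : 0 ≤ N t := by simp only [hN]; positivity
      have : N t / Real.log (r (t + 1)) ≤ N t / (Real.log (t + 1) / 2) :=
        div_le_div_of_nonneg_left h5 (by linarith) h1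
      refine this.trans (le_of_eq ?_)
      field_simp
  · filter_upwards [hy, hL_top.eventually_gt_atTop 0, hlog1.eventually_ge_atTop 1] with t hyt hLt hlt
    have hrt := hr t
    have hrt1 := hr (t + 1)
    have hσ : 1 ≤ r (t + 1) / r t := by rw [one_le_div hrt]; exact hmono t
    set l := 4 * Real.log ((t : ℝ) + 1) with hl
    have hl4 : 4 ≤ l := by linarith
    set M := l * (r (t + 1) / r t) with hM
    have hM1 : 1 ≤ M := by nlinarith
    have hyM : (|y2 t| ^ a) ^ 2 ≤ M ^ a := by
      rw [← Real.rpow_natCast, ← Real.rpow_mul (abs_nonneg _), mul_comm, Real.rpow_mul (abs_nonneg _),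
        Real.rpow_natCast, sq_abs]
      exact Real.rpow_le_rpow (sq_nonneg _) hyt (by linarith)
    have hMa : 1 ≤ M ^ a := Real.one_le_rpow hM1 (by linarith)
    have hsq : (γ₁ + γ₂ * |y2 t| ^ a) ^ 2 ≤ C * M ^ a := by
      set s := Real.sqrt (M ^ a) with hs
      have hs2 : s ^ 2 = M ^ a := Real.sq_sqrt (by linarith)
      have hs1 : 1 ≤ s := Real.one_le_sqrt.2 hMa
      have hys : |y2 t| ^ a ≤ s := Real.le_sqrt_of_sq_le hyM
      have hy0 : 0 ≤ |y2 t| ^ a := by positivity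
      rw [← hs2, hC, ← mul_pow]
      refine pow_le_pow_left₀ (by positivity) ?_ 2
      nlinarith
    have hmain : r (t + 2) ≤ 2 * max (r (t + 1)) (C * M ^ a) := by
      have := hstep t
      have h1 := le_max_left (r (t + 1)) (C * M ^ a)
      have h2 := le_max_right (r (t + 1)) (C * M ^ a)
      linarith
    have hL1 : Real.log (r t) ≤ Real.log (r (t + 1)) := Real.log_le_log hrt (hmono t)
    have hL1pos : 0 < Real.log (r (t + 1)) := by linarith
    have h3 : 0 ≤ Real.log l := Real.log_nonneg (by linarith)
    have hlogM : Real.log M = Real.log l + (Real.log (r (t + 1)) - Real.log (r t)) := by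
      rw [hM, Real.log_mul (by positivity) (by positivity), Real.log_div hrt1.ne' hrt.ne']
    have hlog : Real.log (r (t + 2)) ≤
        max (Real.log (r (t + 1))) (a * (Real.log (r (t + 1)) - Real.log (r t))) + N t := by
      have habs := le_abs_self (Real.log C)
      have habs0 := abs_nonneg (Real.log C)
      have hNt : N t = |Real.log C| + a * Real.log l + Real.log 2 := rfl
      have hal : 0 ≤ a * Real.log l := by positivity
      have hcase : Real.log (max (r (t + 1)) (C * M ^ a)) ≤
          max (Real.log (r (t + 1))) (a * (Real.log (r (t + 1)) - Real.log (r t)))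
            + |Real.log C| + a * Real.log l := by
        rcases max_cases (r (t + 1)) (C * M ^ a) with ⟨h, _⟩ | ⟨h, _⟩
        · rw [h]
          have := le_max_left (Real.log (r (t + 1))) (a * (Real.log (r (t + 1)) - Real.log (r t)))
          linarith
        · rw [h, Real.log_mul hC0.ne' (by positivity), Real.log_rpow (by linarith), hlogM]
          have := le_max_right (Real.log (r (t + 1))) (a * (Real.log (r (t + 1)) - Real.log (r t)))
          linarith
      have := Real.log_le_log (hr (t + 2)) hmain
      rw [Real.log_mul (by norm_num) (by positivity)] at this
      linarith
    show Real.log (r (t + 2)) / Real.log (r (t + 1)) ≤ _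
    rw [div_le_iff₀ hL1pos, add_mul, div_mul_cancel₀ _ hL1pos.ne', max_mul_of_nonneg _ _ hL1pos.le]
    have e1 : a * (1 - 1 / (Real.log (r (t + 1)) / Real.log (r t))) * Real.log (r (t + 1))
        = a * (Real.log (r (t + 1)) - Real.log (r t)) := by
      field_simp
    rw [e1, one_mul]
    exact hlog

lemma aux_int (f : ℝ → ℝ) (hf : Measurable f) (ε p : ℝ) (hε : 0 < ε) (v : NNReal)
    (hp : p ≤ (gaussianReal 0 v).real {x | ε ≤ f x ^ 2}) :
    ∫⁻ z, ENNReal.ofReal (Real.exp (-(f z) ^ 2)) ∂(gaussianReal 0 v)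
      ≤ ENNReal.ofReal (1 - p * (1 - Real.exp (-ε))) := by
  have hB : MeasurableSet {x | ε ≤ f x ^ 2} := measurableSet_le measurable_const (hf.pow_const 2)
  have hi : Integrable (fun z => Real.exp (-(f z) ^ 2)) (gaussianReal 0 v) := by
    refine Integrable.of_bound (C := 1) (by fun_prop) (ae_of_all _ fun z => ?_)
    rw [Real.norm_of_nonneg (Real.exp_pos _).le, Real.exp_le_one_iff]
    nlinarith [sq_nonneg (f z)]
  rw [← ofReal_integral_eq_lintegral_ofReal hi (ae_of_all _ fun z => (Real.exp_pos _).le)]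
  refine ENNReal.ofReal_le_ofReal ?_
  have hi2 : Integrable (Set.indicator {x | ε ≤ f x ^ 2} (fun _ => 1 - Real.exp (-ε)))
    (gaussianReal 0 v) := (integrable_const _).indicator hB
  have h0 : 0 < 1 - Real.exp (-ε) := by
    have : Real.exp (-ε) < 1 := by rw [Real.exp_lt_one_iff]; linarith
    linarith
  calc ∫ z, Real.exp (-(f z) ^ 2) ∂(gaussianReal 0 v)
      ≤ ∫ z, (1 - Set.indicator {x | ε ≤ f x ^ 2} (fun _ => 1 - Real.exp (-ε)) z)
          ∂(gaussianReal 0 v) := by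
        refine integral_mono hi ((integrable_const _).sub hi2) fun z => ?_
        by_cases hz : ε ≤ f z ^ 2
        · have hz' : z ∈ {x | ε ≤ f x ^ 2} := hz
          simp only [Set.indicator_of_mem hz', sub_sub_cancel]
          exact Real.exp_le_exp.2 (by linarith)
        · have hz' : z ∉ {x | ε ≤ f x ^ 2} := hz
          simp only [Set.indicator_of_notMem hz', sub_zero]
          rw [Real.exp_le_one_iff]
          nlinarith [sq_nonneg (f z)]
    _ = 1 - (gaussianReal 0 v).real {x | ε ≤ f x ^ 2} * (1 - Real.exp (-ε)) := by
        rw [integral_sub (integrable_const _) hi2, integral_indicator hB]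
        simp
    _ ≤ _ := by nlinarith

lemma aux_eps (f : ℝ → ℝ) (hpos : 0 < volume {x : ℝ | 0 < |f x|}) (b : ℝ) (hb : 0 < b) :
    ∃ ε, 0 < ε ∧ ε ≤ b ∧ 0 < volume {x | ε ≤ f x ^ 2} := by
  have hU : {x : ℝ | 0 < |f x|} ⊆ ⋃ n : ℕ, {x | 1 / ((n : ℝ) + 1) ≤ f x ^ 2} := by
    intro x hx
    have hx' : 0 < |f x| := hx
    have : 0 < f x ^ 2 := by rw [← sq_abs]; positivity
    obtain ⟨n, hn⟩ := exists_nat_one_div_lt this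
    exact Set.mem_iUnion.2 ⟨n, hn.le⟩
  have h1 := (hpos.trans_le (measure_mono hU)).ne'
  have h2 : ∃ n : ℕ, volume {x | 1 / ((n : ℝ) + 1) ≤ f x ^ 2} ≠ 0 := by
    by_contra! hcon
    exact h1 (measure_iUnion_null hcon)
  obtain ⟨n, hn⟩ := h2
  refine ⟨min (1 / ((n : ℝ) + 1)) b, lt_min (by positivity) hb, min_le_right _ _, ?_⟩
  refine lt_of_lt_of_le (pos_iff_ne_zero.2 hn) (measure_mono fun x hx => ?_)
  have hx' : 1 / ((n : ℝ) + 1) ≤ f x ^ 2 := hx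
  show min (1 / ((n : ℝ) + 1)) b ≤ f x ^ 2
  exact (min_le_left _ _).trans hx'

lemma aux_growth {Ω : Type*} [MeasurableSpace Ω] (P : Measure Ω) [IsProbabilityMeasure P]
    (R : ℕ → Ω → ℝ) (hRm : ∀ t, Measurable (R t)) (hR0 : ∀ t ω, 0 < R t ω)
    (hmono : ∀ t ω, R t ω ≤ R (t + 1) ω) (ρ : ℝ) (hρ0 : 0 < ρ) (hρ1 : ρ < 1)
    (hstep : ∀ t, ∫⁻ ω, ENNReal.ofReal (Real.exp (-R (t + 3) ω)) ∂P
      ≤ ENNReal.ofReal ρ * ∫⁻ ω, ENNReal.ofReal (Real.exp (-R (t + 1) ω)) ∂P) :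
    ∃ c, 0 < c ∧ ∀ᵐ ω ∂P, ∀ᶠ t : ℕ in atTop, c * t ≤ R t ω := by
  have hk : ∀ k : ℕ, ∫⁻ ω, ENNReal.ofReal (Real.exp (-R (2 * k + 1) ω)) ∂P
      ≤ ENNReal.ofReal (ρ ^ k) := by
    intro k
    induction k with
    | zero =>
      calc ∫⁻ ω, ENNReal.ofReal (Real.exp (-R (2 * 0 + 1) ω)) ∂P ≤ ∫⁻ ω, 1 ∂P := by
            refine lintegral_mono fun ω => ?_
            rw [ENNReal.ofReal_le_one, Real.exp_le_one_iff]
            linarith [hR0 (2 * 0 + 1) ω]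
        _ ≤ _ := by simp
    | succ k ih =>
      refine (hstep (2 * k)).trans ?_
      rw [pow_succ', ENNReal.ofReal_mul hρ0.le]
      gcongr
  set s := Real.sqrt ρ with hs
  have hs2 : s * s = ρ := Real.mul_self_sqrt hρ0.le
  have hs0 : 0 < s := Real.sqrt_pos.2 hρ0
  have hs1 : s < 1 := by nlinarith
  have hmk : ∀ k : ℕ, P {ω | s ^ k ≤ Real.exp (-R (2 * k + 1) ω)} ≤ ENNReal.ofReal (s ^ k) := by
    intro k
    have hm := meas_ge_le_lintegral_div (μ := P)
      (f := fun ω => ENNReal.ofReal (Real.exp (-R (2 * k + 1) ω)))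
      (ε := ENNReal.ofReal (s ^ k)) (by have := hRm (2 * k + 1); fun_prop)
      (by simpa using pow_pos hs0 k) ENNReal.ofReal_ne_top
    have hsub : {ω | s ^ k ≤ Real.exp (-R (2 * k + 1) ω)} ⊆
        {ω | ENNReal.ofReal (s ^ k) ≤ ENNReal.ofReal (Real.exp (-R (2 * k + 1) ω))} :=
      fun ω hω => ENNReal.ofReal_le_ofReal hω
    refine (measure_mono hsub).trans (hm.trans ?_)
    refine (ENNReal.div_le_div_right (hk k) _).trans ?_
    rw [← ENNReal.ofReal_div_of_pos (pow_pos hs0 k)]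
    refine ENNReal.ofReal_le_ofReal (le_of_eq ?_)
    rw [← hs2, mul_pow, mul_div_cancel_right₀ _ (pow_pos hs0 k).ne']
  have hsum : ∑' k : ℕ, P {ω | s ^ k ≤ Real.exp (-R (2 * k + 1) ω)} ≠ ⊤ := by
    refine ne_top_of_le_ne_top ?_ (ENNReal.tsum_le_tsum hmk)
    exact (summable_geometric_of_lt_one hs0.le hs1).tsum_ofReal_ne_top
  have hae := ae_eventually_notMem hsum
  have hlog : 0 < -Real.log s := by
    have := Real.log_neg hs0 hs1
    linarith
  refine ⟨-Real.log s / 4, by positivity, ?_⟩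
  filter_upwards [hae] with ω hω
  obtain ⟨K, hK⟩ := eventually_atTop.1 hω
  have hmon : Monotone (fun t => R t ω) := monotone_nat_of_le_succ fun t => hmono t ω
  filter_upwards [eventually_ge_atTop (2 * K + 4)] with t ht
  set k := (t - 1) / 2 with hkdef
  have h1 : 2 * k + 1 ≤ t := by omega
  have h2 : t ≤ 4 * k := by omega
  have h3 := hK k (by omega)
  have h4 : Real.exp (-R (2 * k + 1) ω) < s ^ k := lt_of_not_ge h3
  have h5 := (Real.log_lt_log (Real.exp_pos _) h4)
  rw [Real.log_exp, Real.log_pow] at h5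
  have h6 : R (2 * k + 1) ω ≤ R t ω := hmon h1
  have h7 : (t : ℝ) ≤ 4 * k := by exact_mod_cast h2
  nlinarith

/-- Lemma 7(ii): in the closed-loop least-squares setup, with `a ≥ 4`,
`|f x| ≤ γ₁ + γ₂ |x|^a` and `{x : |f x| > 0}` of positive Lebesgue measure, almost surely
`limsup (log r t)/(log r (t-1)) ≤ 1 + x_max`, where `x_max = ((a-2) + √((a-2)² - 4))/2`. -/
theorem stmt_17
    {Ω : Type*} [MeasurableSpace Ω] (P : Measure Ω) [IsProbabilityMeasure P]
    (y : ℕ → Ω → ℝ) (hy : ∀ t, Measurable (y t))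
    (f : ℝ → ℝ) (hf : Measurable f)
    (P₀ : ℝ) (hP₀ : 0 < P₀)
    (R σ2 : ℕ → Ω → ℝ)
    (hR : ∀ t ω, R t ω = P₀⁻¹ + ∑ i ∈ Finset.range t, (f (y i ω)) ^ 2)
    (hσ2 : ∀ t ω, σ2 t ω = R (t + 1) ω / R t ω)
    (𝔉 : ℕ → MeasurableSpace Ω)
    (h𝔉 : ∀ t, 𝔉 t = ⨆ i : Fin (t + 1), MeasurableSpace.comap (y i) inferInstance)
    (hGauss : ∀ t : ℕ, ∀ A : Set ℝ, MeasurableSet A →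
      (P[Set.indicator {ω | y (t + 1) ω ∈ A} (fun _ => (1 : ℝ))|𝔉 t]) =ᵐ[P]
        fun ω => (2 * Real.pi * σ2 t ω) ^ (-(1 : ℝ) / 2) *
          ∫ x in A, Real.exp (-x ^ 2 / (2 * σ2 t ω)))
    (a γ₁ γ₂ : ℝ) (ha : 4 ≤ a) (hγ₁ : 0 < γ₁) (hγ₂ : 0 < γ₂)
    (hfgrow : ∀ x : ℝ, |f x| ≤ γ₁ + γ₂ * |x| ^ a)
    (hpos : 0 < volume {x : ℝ | 0 < |f x|}) :
    P {ω | ((1 + (a - 2 + Real.sqrt ((a - 2) ^ 2 - 4)) / 2 : ℝ) : EReal) <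
      Filter.limsup (fun t : ℕ =>
        ((Real.log (R (t + 1) ω) / Real.log (R t ω) : ℝ) : EReal)) Filter.atTop} = 0 := by
  have hR0 : ∀ t ω, 0 < R t ω := fun t ω => by
    rw [hR]
    have : 0 ≤ ∑ i ∈ Finset.range t, (f (y i ω)) ^ 2 := Finset.sum_nonneg fun i _ => sq_nonneg _
    positivity
  have hRs : ∀ t ω, R (t + 1) ω = R t ω + f (y t ω) ^ 2 := fun t ω => by
    rw [hR, hR, Finset.sum_range_succ, add_assoc]
  have hmono : ∀ t ω, R t ω ≤ R (t + 1) ω := fun t ω => by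
    rw [hRs]; nlinarith [sq_nonneg (f (y t ω))]
  have hRge : ∀ t ω, P₀⁻¹ ≤ R t ω := fun t ω => by
    rw [hR]
    have : 0 ≤ ∑ i ∈ Finset.range t, (f (y i ω)) ^ 2 := Finset.sum_nonneg fun i _ => sq_nonneg _
    linarith
  have hFle : ∀ t, 𝔉 t ≤ (inferInstance : MeasurableSpace Ω) := fun t => by
    rw [h𝔉]
    exact iSup_le fun i => (hy i).comap_le
  have hyF : ∀ t i, i ≤ t → Measurable[𝔉 t] (y i) := fun t i hi => by
    rw [h𝔉, measurable_iff_comap_le]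
    exact le_iSup (fun i : Fin (t + 1) => MeasurableSpace.comap (y i) inferInstance)
      ⟨i, Nat.lt_succ_of_le hi⟩
  have hRF : ∀ t s, s ≤ t + 1 → Measurable[𝔉 t] (R s) := fun t s hs => by
    have : R s = fun ω => P₀⁻¹ + ∑ i ∈ Finset.range s, (f (y i ω)) ^ 2 := funext fun ω => hR s ω
    rw [this]
    refine Measurable.const_add (Finset.measurable_sum _ fun i hi => ?_) _
    have hi' := Finset.mem_range.1 hi
    exact (hf.comp (hyF t i (by omega))).pow_const 2
  have hRm : ∀ t, Measurable (R t) := fun t => (hRF t t (by omega)).mono (hFle t) le_rfl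
  -- integral formula
  have hker : ∀ t, ∀ g : (ℝ × ℝ) × ℝ → ENNReal, Measurable g →
      ∫⁻ ω, g ((R t ω, R (t + 1) ω), y (t + 1) ω) ∂P
        = ∫⁻ ω, ∫⁻ z, g ((R t ω, R (t + 1) ω), z)
          ∂(gaussianReal 0 (R (t + 1) ω / R t ω).toNNReal) ∂P := by
    intro t g hg
    refine aux_kernel P (hFle t) (fun ω => (R t ω, R (t + 1) ω))
      ((hRF t t (by omega)).prodMk (hRF t (t + 1) le_rfl))
      (fun ω => div_pos (hR0 _ _) (hR0 _ _)) (y (t + 1)) (hy _) ?_ g hg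
    intro A hA
    have := hGauss t A hA
    simp only [hσ2] at this
    exact this
  -- growth
  obtain ⟨ε, hε0, hεb, hεv⟩ := aux_eps f hpos P₀⁻¹ (by positivity)
  obtain ⟨p, hp0, hp⟩ := aux_lower _ hεv
  have hexp : Real.exp (-ε) < 1 := by rw [Real.exp_lt_one_iff]; linarith
  have hexp0 := Real.exp_pos (-ε)
  have hgrow : ∃ c, 0 < c ∧ ∀ᵐ ω ∂P, ∀ᶠ t : ℕ in atTop, c * t ≤ R t ω := by
    refine aux_growth P R hRm hR0 hmono (max (Real.exp (-ε)) (1 - p * (1 - Real.exp (-ε))))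
      (lt_max_of_lt_left hexp0) (max_lt hexp (by nlinarith)) ?_
    intro t
    set ρ := max (Real.exp (-ε)) (1 - p * (1 - Real.exp (-ε))) with hρ
    have h1 := hker (t + 1) (fun q => ENNReal.ofReal (Real.exp (-(q.1.2 + f q.2 ^ 2))))
      (by fun_prop)
    have h2 : ∀ ω, Real.exp (-R (t + 3) ω)
        = Real.exp (-(R (t + 2) ω + f (y (t + 2) ω) ^ 2)) := fun ω => by rw [hRs (t + 2)]
    simp only [h2]
    have h1' : ∫⁻ ω, ENNReal.ofReal (Real.exp (-(R (t + 2) ω + f (y (t + 2) ω) ^ 2))) ∂P = _ := h1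
    rw [h1', ← lintegral_const_mul _ (by have := hRm (t + 1); fun_prop)]
    refine lintegral_mono fun ω => ?_
    have e1 : ∀ z, ENNReal.ofReal (Real.exp (-(R (t + 2) ω + f z ^ 2)))
        = ENNReal.ofReal (Real.exp (-R (t + 2) ω)) * ENNReal.ofReal (Real.exp (-(f z) ^ 2)) := by
      intro z
      rw [← ENNReal.ofReal_mul (Real.exp_pos _).le, ← Real.exp_add]
      congr 2
      ring
    show ∫⁻ z, ENNReal.ofReal (Real.exp (-(R (t + 2) ω + f z ^ 2)))
      ∂(gaussianReal 0 (R (t + 2) ω / R (t + 1) ω).toNNReal) ≤ _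
    simp only [e1]
    rw [lintegral_const_mul _ (by fun_prop)]
    have hr1 := hR0 (t + 1) ω
    have hr2 := hRs (t + 1) ω
    have hm12 := hmono (t + 1) ω
    by_cases hcase : ε ≤ f (y (t + 1) ω) ^ 2
    · have hle : ∫⁻ z, ENNReal.ofReal (Real.exp (-(f z) ^ 2))
          ∂(gaussianReal 0 (R (t + 2) ω / R (t + 1) ω).toNNReal) ≤ 1 := by
        calc _ ≤ ∫⁻ z, 1 ∂(gaussianReal 0 (R (t + 2) ω / R (t + 1) ω).toNNReal) := by
              refine lintegral_mono fun z => ?_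
              rw [ENNReal.ofReal_le_one, Real.exp_le_one_iff]
              nlinarith [sq_nonneg (f z)]
          _ = 1 := by simp
      refine (mul_le_mul_right hle _).trans ?_
      rw [mul_one, ← ENNReal.ofReal_mul (hexp0.le.trans (le_max_left _ _))]
      refine ENNReal.ofReal_le_ofReal ?_
      calc Real.exp (-R (t + 2) ω) ≤ Real.exp (-ε) * Real.exp (-R (t + 1) ω) := by
            rw [← Real.exp_add]
            refine Real.exp_le_exp.2 ?_
            have : R (t + 2) ω = R (t + 1) ω + f (y (t + 1) ω) ^ 2 := hr2
            linarith
        _ ≤ _ := mul_le_mul_of_nonneg_right (le_max_left _ _) (Real.exp_pos _).le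
    · have hq1 : 1 ≤ R (t + 2) ω / R (t + 1) ω := by rw [one_le_div hr1]; exact hm12
      have hq2 : R (t + 2) ω / R (t + 1) ω ≤ 2 := by
        rw [div_le_iff₀ hr1]
        have : R (t + 2) ω = R (t + 1) ω + f (y (t + 1) ω) ^ 2 := hr2
        have := hRge (t + 1) ω
        push Not at hcase
        linarith
      have hbnd := aux_int f hf ε p hε0 (R (t + 2) ω / R (t + 1) ω).toNNReal
        (hp _ (by rw [Real.le_toNNReal_iff_coe_le (by linarith)]; simpa using hq1)
          (by rw [Real.toNNReal_le_iff_le_coe]; simpa using hq2))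
      rw [mul_comm]
      refine mul_le_mul' (hbnd.trans (ENNReal.ofReal_le_ofReal (le_max_right _ _))) ?_
      exact ENNReal.ofReal_le_ofReal (Real.exp_le_exp.2 (neg_le_neg hm12))
  obtain ⟨c, hc0, hc⟩ := hgrow
  -- tail bound
  have htail : ∀ t : ℕ,
      P {ω | 4 * Real.log ((t : ℝ) + 1) * (R (t + 1) ω / R t ω) < y (t + 1) ω ^ 2}
        ≤ ENNReal.ofReal (2 * (1 / ((t : ℝ) + 1) ^ 2)) := by
    intro t
    have hlog0 : 0 ≤ Real.log ((t : ℝ) + 1) := Real.log_nonneg (by simp)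
    set D : Set ((ℝ × ℝ) × ℝ) :=
      {q | 4 * Real.log ((t : ℝ) + 1) * (q.1.2 / q.1.1) < q.2 ^ 2} with hD
    have hDm : MeasurableSet D := measurableSet_lt (by fun_prop) (by fun_prop)
    have h1 := hker t (D.indicator 1) (measurable_one.indicator hDm)
    have hleft : ∫⁻ ω, D.indicator 1 ((R t ω, R (t + 1) ω), y (t + 1) ω) ∂P
        = P {ω | 4 * Real.log ((t : ℝ) + 1) * (R (t + 1) ω / R t ω) < y (t + 1) ω ^ 2} := by
      have hm : Measurable fun ω => ((R t ω, R (t + 1) ω), y (t + 1) ω) :=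
        ((hRm t).prodMk (hRm (t + 1))).prodMk (hy _)
      have hi := lintegral_indicator_one (μ := P) (hm hDm)
      exact hi
    rw [← hleft, h1]
    calc _ ≤ ∫⁻ ω, ENNReal.ofReal (2 * (1 / ((t : ℝ) + 1) ^ 2)) ∂P := by
          refine lintegral_mono fun ω => ?_
          have hq := div_pos (hR0 (t + 1) ω) (hR0 t ω)
          have hms : MeasurableSet {z : ℝ | 4 * Real.log ((t : ℝ) + 1)
              * ((R (t + 1) ω / R t ω).toNNReal : ℝ) < z ^ 2} :=
            measurableSet_lt (by fun_prop) (by fun_prop)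
          have h2 := aux_tail (R (t + 1) ω / R t ω).toNNReal (by simpa using hq)
            (4 * Real.log ((t : ℝ) + 1)) (by positivity)
          rw [← lintegral_indicator_one hms] at h2
          have h3 : Real.exp (-(4 * Real.log ((t : ℝ) + 1)) / 2) = 1 / ((t : ℝ) + 1) ^ 2 := by
            have : -(4 * Real.log ((t : ℝ) + 1)) / 2 = -(Real.log (((t : ℝ) + 1) ^ 2)) := by
              rw [Real.log_pow]; push_cast; ring
            rw [this, Real.exp_neg, Real.exp_log (by positivity), one_div]
          rw [h3, Real.coe_toNNReal _ hq.le] at h2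
          exact h2
      _ = _ := by simp
  have hsum : ∑' t : ℕ,
      P {ω | 4 * Real.log ((t : ℝ) + 1) * (R (t + 1) ω / R t ω) < y (t + 1) ω ^ 2} ≠ ⊤ := by
    refine ne_top_of_le_ne_top ?_ (ENNReal.tsum_le_tsum htail)
    refine Summable.tsum_ofReal_ne_top (Summable.mul_left _ ?_)
    have := (summable_nat_add_iff 1).2 (Real.summable_one_div_nat_pow.2 (one_lt_two))
    simpa using this
  have hae := ae_eventually_notMem hsum
  have hfinal : ∀ᵐ ω ∂P, ¬ (((1 + (a - 2 + Real.sqrt ((a - 2) ^ 2 - 4)) / 2 : ℝ) : EReal) <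
      Filter.limsup (fun t : ℕ =>
        ((Real.log (R (t + 1) ω) / Real.log (R t ω) : ℝ) : EReal)) Filter.atTop) := by
    filter_upwards [hae, hc] with ω h1 h2
    rw [not_lt]
    refine aux_det (fun t => R t ω) (fun t => y (t + 1) ω) a γ₁ γ₂ c ha hγ₁ hγ₂ hc0
      (fun t => hR0 t ω) (fun t => hmono t ω) h2 ?_ ?_
    · intro t
      have h3 := hRs (t + 1) ω
      have h4 : f (y (t + 1) ω) ^ 2 ≤ (γ₁ + γ₂ * |y (t + 1) ω| ^ a) ^ 2 := by
        rw [← sq_abs (f _)]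
        exact pow_le_pow_left₀ (abs_nonneg _) (hfgrow _) 2
      show R (t + 2) ω ≤ R (t + 1) ω + _
      have h5 : R (t + 2) ω = R (t + 1) ω + f (y (t + 1) ω) ^ 2 := h3
      linarith
    · filter_upwards [h1] with t ht
      exact le_of_not_gt ht
  have := ae_iff.1 hfinal
  simpa only [not_not] using this
end
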